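/- Let k be an algebraically closed field of characteristic p with p > 0 and p ≠ 3. Let f, g ∈ k[X₀,X₁,X₂,X₃] be homogeneous of degree 2 such that f and g have a common zero in k⁴ ∖ {0}, and at every common zero a ∈ k⁴ ∖ {0} the gradient vectors (∂f/∂X₀(a),…,∂f/∂X₃(a)) and (∂g/∂X₀(a),…,∂g/∂X₃(a)) are linearly independent over k (so C = V₊(f,g) ⊂ ℙ³ is a smooth complete intersection elliptic curve). Set R = k[X₀,X₁,X₂,X₃]/(f,g). Then for every e ≥ 0, writing q = p^e, 3 · dim_k( R/(X₀^q, X₁^q, X₂^q, X₃^q) ) = 8q² − 5; that is, the Hilbert–Kunz function of the maximal ideal (X₀,X₁,X₂,X₃) is φ(q) = (8/3)q² − 5/3. -/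

import Mathlib

open MvPolynomial

section Homogeneous

variable {σ k : Type*} [CommRing k]

theorem MvPolynomial.homogeneousComponent_mul_of_isHomogeneous {u : MvPolynomial σ k} {m : ℕ}
    (hu : u.IsHomogeneous m) (y : MvPolynomial σ k) (n : ℕ) :
    homogeneousComponent n (u * y) =
      if m ≤ n then u * homogeneousComponent (n - m) y else 0 := by
  let := MvPolynomial.gradedAlgebra (σ := σ) (R := k)
  have h := DirectSum.coe_decompose_mul_of_left_mem (homogeneousSubmodule σ k) (b := y) n
    ((mem_homogeneousSubmodule m u).2 hu)
  have key : ∀ (z : MvPolynomial σ k) (i : ℕ),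
      (DirectSum.decompose (homogeneousSubmodule σ k) z i : MvPolynomial σ k) =
        homogeneousComponent i z := fun z i => decomposition.decompose'_apply z i
  simpa only [key] using h

theorem Ideal.isHomogeneous_span_of_mvPolynomial {s : Set (MvPolynomial σ k)}
    (h : ∀ x ∈ s, ∃ n, x.IsHomogeneous n) {x : MvPolynomial σ k} (hx : x ∈ Ideal.span s) (n : ℕ) :
    homogeneousComponent n x ∈ Ideal.span s := by
  let := MvPolynomial.gradedAlgebra (σ := σ) (R := k)
  refine homogeneousComponent_mem_of_mem (Ideal.homogeneous_span _ _ ?_) hx n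
  intro y hy
  obtain ⟨m, hm⟩ := h y hy
  exact ⟨m, (mem_homogeneousSubmodule m y).2 hm⟩

/-- Homogeneous coefficients can be chosen in a representation of a homogeneous element modulo a
homogeneous ideal. -/
theorem MvPolynomial.IsHomogeneous.exists_coeffs {ι : Type*} [Fintype ι]
    {s : Set (MvPolynomial σ k)} (h : ∀ x ∈ s, ∃ n, x.IsHomogeneous n) {x : MvPolynomial σ k}
    {n m : ℕ} (hx : x.IsHomogeneous n) {u : ι → MvPolynomial σ k} (hu : ∀ i, (u i).IsHomogeneous m)
    {y : ι → MvPolynomial σ k} (hxy : x - ∑ i, u i * y i ∈ Ideal.span s) :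
    ∃ y' : ι → MvPolynomial σ k, (∀ i, (y' i).IsHomogeneous (n - m)) ∧ (n < m → ∀ i, y' i = 0) ∧
      x - ∑ i, u i * y' i ∈ Ideal.span s := by
  have h1 := Ideal.isHomogeneous_span_of_mvPolynomial h hxy n
  rw [map_sub, map_sum, homogeneousComponent_of_mem hx, if_pos rfl] at h1
  simp only [homogeneousComponent_mul_of_isHomogeneous (hu _)] at h1
  by_cases hmn : m ≤ n
  · refine ⟨fun i => homogeneousComponent (n - m) (y i),
      fun i => homogeneousComponent_isHomogeneous _ _, fun h => absurd h (not_lt.2 hmn), ?_⟩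
    simpa [hmn] using h1
  · refine ⟨0, fun i => isHomogeneous_zero _ _ _, fun _ _ => rfl, ?_⟩
    simpa [hmn] using h1

end Homogeneous

/-- If `u ∣ v * x` implies `u ∣ x`, the same holds for powers of `u` and `v`. -/
theorem dvd_of_pow_dvd_pow_mul {A : Type*} [CommRing A] [IsDomain A] {u v : A} (hu : u ≠ 0)
    (h : ∀ x, u ∣ v * x → u ∣ x) (n m : ℕ) {x : A} (hx : u ^ n ∣ v ^ m * x) : u ^ n ∣ x := by
  have h1 : ∀ (m : ℕ) (x : A), u ∣ v ^ m * x → u ∣ x := by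
    intro m
    induction m with
    | zero => intro x hx; simpa using hx
    | succ m ih => intro x hx; exact ih x (h _ (by rwa [← mul_assoc, ← pow_succ']))
  induction n generalizing x with
  | zero => simp
  | succ n ih =>
    obtain ⟨y, rfl⟩ := h1 m x ((dvd_pow_self u (Nat.succ_ne_zero n)).trans hx)
    rw [mul_left_comm, pow_succ'] at hx
    rw [pow_succ']
    exact mul_dvd_mul_left u (ih ((mul_dvd_mul_iff_left hu).1 hx))

/-- A graded domain `A` with elements `w, z, t` of degree one satisfying
`z³ = w³ + 3awzt + bt³`, together with the regularity properties of the lines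
`t = 0`, `w = 0`, `z = 0` and `z = ωⁱw + ω²ⁱat` (whose product is `(b - a³)t³`). -/
structure IsCubicCone {A : Type*} [CommRing A] (𝒜 : ℕ → AddSubgroup A) (a b ω w z t : A) :
    Prop where
  mul_mem : ∀ {m n x y}, x ∈ 𝒜 m → y ∈ 𝒜 n → x * y ∈ 𝒜 (m + n)
  one_mem : (1 : A) ∈ 𝒜 0
  div_mem : ∀ {m n u y}, u ≠ 0 → u ∈ 𝒜 m → u * y ∈ 𝒜 n → y ∈ 𝒜 (n - m)
  eq_zero : ∀ {m n u y}, u ∈ 𝒜 m → u * y ∈ 𝒜 n → n < m → u * y = 0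
  a_mem : a ∈ 𝒜 0
  b_mem : b ∈ 𝒜 0
  omega_mem : ω ∈ 𝒜 0
  w_mem : w ∈ 𝒜 1
  z_mem : z ∈ 𝒜 1
  t_mem : t ∈ 𝒜 1
  relation : z ^ 3 = w ^ 3 + 3 * a * w * z * t + b * t ^ 3
  omega_eq : ω ^ 2 + ω + 1 = 0
  isUnit_b : IsUnit b
  isUnit_kappa : IsUnit (b - a ^ 3)
  three_ne_zero : (3 : A) ≠ 0
  w_ne_zero : w ≠ 0
  z_ne_zero : z ≠ 0
  t_ne_zero : t ≠ 0
  t_w : ∀ x, t ∣ w * x → t ∣ x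
  t_z : ∀ x, t ∣ z * x → t ∣ x
  w_t : ∀ x, w ∣ t * x → w ∣ x
  z_w : ∀ x, z ∣ w * x → z ∣ x
  line_one : ∀ (i : ℕ) x,
    z - ω ^ i * w - ω ^ (2 * i) * a * t ∣
      (z - ω ^ (i + 1) * w - ω ^ (2 * (i + 1)) * a * t) * x →
    z - ω ^ i * w - ω ^ (2 * i) * a * t ∣ x
  line_two : ∀ (i : ℕ) x,
    z - ω ^ i * w - ω ^ (2 * i) * a * t ∣
      (z - ω ^ (i + 2) * w - ω ^ (2 * (i + 2)) * a * t) * x →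
    z - ω ^ i * w - ω ^ (2 * i) * a * t ∣ x

namespace IsCubicCone

variable {A : Type*} [CommRing A] {𝒜 : ℕ → AddSubgroup A} {a b ω w z t : A}

theorem pow_mem (h : IsCubicCone 𝒜 a b ω w z t) {n : ℕ} {x : A} (hx : x ∈ 𝒜 n) (m : ℕ) :
    x ^ m ∈ 𝒜 (m * n) := by
  induction m with
  | zero => simpa using h.one_mem
  | succ m ih =>
    rw [pow_succ, Nat.succ_mul]
    exact h.mul_mem ih hx

theorem zero_mul_mem (h : IsCubicCone 𝒜 a b ω w z t) {n : ℕ} {u x : A} (hu : u ∈ 𝒜 0)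
    (hx : x ∈ 𝒜 n) : u * x ∈ 𝒜 n := by
  simpa using h.mul_mem hu hx

theorem omega_pow_three (h : IsCubicCone 𝒜 a b ω w z t) : ω ^ 3 = 1 := by
  linear_combination (ω - 1) * h.omega_eq

theorem omega_pow_mem (h : IsCubicCone 𝒜 a b ω w z t) (n : ℕ) : ω ^ n ∈ 𝒜 0 := by
  simpa using h.pow_mem h.omega_mem n

theorem pow_mem_one (h : IsCubicCone 𝒜 a b ω w z t) {x : A} (hx : x ∈ 𝒜 1) (m : ℕ) :
    x ^ m ∈ 𝒜 m := by
  simpa using h.pow_mem hx m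

variable (a ω w z t) in
/-- The linear form `z - ζw - ζ²at` for the cube root of unity `ζ = ωⁱ`. -/
def line (i : ℕ) : A := z - ω ^ i * w - ω ^ (2 * i) * a * t

variable (a ω w z t) in
/-- The product of the two lines other than `line i`. -/
def coline (i : ℕ) : A :=
  z ^ 2 + ω ^ i * w * z + ω ^ (2 * i) * w ^ 2 +
    t * (ω ^ (2 * i) * a * z - a * w + ω ^ i * a ^ 2 * t)

theorem omega_pow_cube (h : IsCubicCone 𝒜 a b ω w z t) (i : ℕ) : (ω ^ i) ^ 3 = 1 := by
  rw [← pow_mul, mul_comm, pow_mul, h.omega_pow_three, one_pow]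

theorem line_mul_coline (h : IsCubicCone 𝒜 a b ω w z t) (i : ℕ) :
    line a ω w z t i * coline a ω w z t i = (b - a ^ 3) * t ^ 3 := by
  have h1 := h.omega_pow_cube i
  simp only [line, coline, mul_comm 2 i, pow_mul]
  generalize ω ^ i = ζ at h1
  linear_combination h.relation - (w ^ 3 + a ^ 3 * t ^ 3 + 2 * a * w * z * t +
    z * ζ * a ^ 2 * t ^ 2 + ζ * w ^ 2 * a * t) * h1

theorem coline_eq (h : IsCubicCone 𝒜 a b ω w z t) (i : ℕ) :
    coline a ω w z t i = line a ω w z t (i + 1) * line a ω w z t (i + 2) := by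
  have h1 := h.omega_pow_cube i
  have h2 := h.omega_eq
  have h3 := h.omega_pow_three
  simp only [line, coline, mul_comm 2, pow_mul, pow_add, pow_one]
  generalize ω ^ i = ζ at h1
  linear_combination (z * w * ζ + a * z * t * ζ ^ 2 * (1 - ω + ω ^ 2) -
      a * w * t * (ω ^ 3 - ω + 1)) * h2 - (w ^ 2 * ζ ^ 2 + a ^ 2 * t ^ 2 * ζ * (ω ^ 3 + 1)) * h3 -
    (a * w * t * (ω ^ 5 + ω ^ 4) + a ^ 2 * t ^ 2 * ζ * ω ^ 6) * h1

theorem eq_zero_of_dvd (h : IsCubicCone 𝒜 a b ω w z t) {m n : ℕ} {u x : A} (hu : u ∈ 𝒜 m)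
    (hx : x ∈ 𝒜 n) (hmn : n < m) (hux : u ∣ x) : x = 0 := by
  obtain ⟨y, rfl⟩ := hux
  exact h.eq_zero hu hx hmn

theorem line_mem (h : IsCubicCone 𝒜 a b ω w z t) (i : ℕ) : line a ω w z t i ∈ 𝒜 1 := by
  refine sub_mem (sub_mem h.z_mem ?_) ?_
  · exact h.zero_mul_mem (h.omega_pow_mem _) h.w_mem
  · exact h.zero_mul_mem (h.zero_mul_mem (h.omega_pow_mem _) h.a_mem) h.t_mem

variable [IsDomain A]

theorem kappa_mul_ne_zero (h : IsCubicCone 𝒜 a b ω w z t) : (b - a ^ 3) * t ^ 3 ≠ 0 :=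
  mul_ne_zero h.isUnit_kappa.ne_zero (pow_ne_zero _ h.t_ne_zero)

theorem line_ne_zero (h : IsCubicCone 𝒜 a b ω w z t) (i : ℕ) : line a ω w z t i ≠ 0 :=
  left_ne_zero_of_mul (h.line_mul_coline i ▸ h.kappa_mul_ne_zero)

theorem coline_ne_zero (h : IsCubicCone 𝒜 a b ω w z t) (i : ℕ) : coline a ω w z t i ≠ 0 :=
  right_ne_zero_of_mul (h.line_mul_coline i ▸ h.kappa_mul_ne_zero)

theorem line_pow_dvd_cube (h : IsCubicCone 𝒜 a b ω w z t) {q i : ℕ} {c : A}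
    (hc : t ^ q ∣ c * coline a ω w z t i ^ q) : line a ω w z t i ^ q ∣ c ^ 3 := by
  obtain ⟨y, hy⟩ := hc
  have h1 : line a ω w z t i ^ q ∣ (coline a ω w z t i ^ q) ^ 2 * c ^ 3 := by
    have h2 : coline a ω w z t i ^ q ≠ 0 := pow_ne_zero _ (h.coline_ne_zero i)
    obtain ⟨v, hv⟩ := h.isUnit_kappa.pow q
    refine ⟨(↑v⁻¹ : A) * y ^ 3, mul_left_cancel₀ h2 ?_⟩
    have h3 : (line a ω w z t i * coline a ω w z t i) ^ q = ↑v * (t ^ q) ^ 3 := by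
      rw [h.line_mul_coline, mul_pow, hv]; ring
    rw [mul_pow] at h3
    have h4 : (↑v : A) * ↑v⁻¹ = 1 := v.mul_inv
    linear_combination ((c * coline a ω w z t i ^ q) ^ 2 + (c * coline a ω w z t i ^ q) * (t ^ q * y) +
      (t ^ q * y) ^ 2) * hy - (↑v⁻¹ : A) * y ^ 3 * h3 - (t ^ q * y) ^ 3 * h4
  rw [← pow_mul, h.coline_eq, mul_pow, mul_assoc] at h1
  refine dvd_of_pow_dvd_pow_mul (h.line_ne_zero i) (h.line_two i) q (q * 2) ?_
  exact dvd_of_pow_dvd_pow_mul (h.line_ne_zero i) (h.line_one i) q (q * 2) h1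

theorem line_mul_line_pow_dvd (h : IsCubicCone 𝒜 a b ω w z t) {q i j : ℕ} {c : A}
    (hij : j = i + 1 ∨ j = i + 2) (hi : line a ω w z t i ^ q ∣ c) (hj : line a ω w z t j ^ q ∣ c) :
    (line a ω w z t i * line a ω w z t j) ^ q ∣ c := by
  obtain ⟨y, rfl⟩ := hj
  have h1 : line a ω w z t i ^ q ∣ y := by
    rcases hij with rfl | rfl
    · exact dvd_of_pow_dvd_pow_mul (h.line_ne_zero i) (h.line_one i) q q hi
    · exact dvd_of_pow_dvd_pow_mul (h.line_ne_zero i) (h.line_two i) q q hi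
  rw [mul_pow, mul_comm]
  exact mul_dvd_mul_left _ h1

theorem eq_zero_of_three_mul_lt (h : IsCubicCone 𝒜 a b ω w z t) {q m i : ℕ} {c : A}
    (hcm : c ∈ 𝒜 m) (hm : 3 * m < q) (hc : t ^ q ∣ c * coline a ω w z t i ^ q) : c = 0 :=
  pow_eq_zero_iff (n := 3) (by norm_num) |>.1 <|
    h.eq_zero_of_dvd (h.pow_mem_one (h.line_mem i) q) (h.pow_mem hcm 3) hm (h.line_pow_dvd_cube hc)

theorem eq_zero_of_three_mul_lt_two_mul (h : IsCubicCone 𝒜 a b ω w z t) {q m i j : ℕ} {c : A}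
    (hij : j = i + 1 ∨ j = i + 2) (hcm : c ∈ 𝒜 m) (hm : 3 * m < q * 2)
    (hi : t ^ q ∣ c * coline a ω w z t i ^ q) (hj : t ^ q ∣ c * coline a ω w z t j ^ q) : c = 0 :=
  pow_eq_zero_iff (n := 3) (by norm_num) |>.1 <|
    h.eq_zero_of_dvd (h.pow_mem (h.mul_mem (h.line_mem i) (h.line_mem j)) q) (h.pow_mem hcm 3) hm
      (h.line_mul_line_pow_dvd hij (h.line_pow_dvd_cube hi) (h.line_pow_dvd_cube hj))

section Frobenius

omit [IsDomain A]

variable (p e : ℕ) [Fact p.Prime] [CharP A p]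

theorem relation_frobenius (h : IsCubicCone 𝒜 a b ω w z t) :
    (z ^ p ^ e) ^ 3 = (w ^ p ^ e) ^ 3 + 3 * a ^ p ^ e * w ^ p ^ e * z ^ p ^ e * t ^ p ^ e +
      b ^ p ^ e * (t ^ p ^ e) ^ 3 := by
  have := congrArg (iterateFrobenius A p e) h.relation
  simpa only [map_add, map_mul, map_pow, iterateFrobenius_def, map_ofNat] using this

theorem omega_frobenius (h : IsCubicCone 𝒜 a b ω w z t) :
    (ω ^ p ^ e) ^ 2 + ω ^ p ^ e + 1 = 0 := by
  have := congrArg (iterateFrobenius A p e) h.omega_eq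
  simpa only [map_add, map_mul, map_pow, iterateFrobenius_def, map_one, map_zero] using this

variable (a ω w z t) in
theorem coline_frobenius (i : ℕ) : ∃ y, coline a ω w z t i ^ p ^ e =
    (z ^ p ^ e) ^ 2 + (ω ^ p ^ e) ^ i * w ^ p ^ e * z ^ p ^ e +
      (ω ^ p ^ e) ^ (2 * i) * (w ^ p ^ e) ^ 2 + t ^ p ^ e * y := by
  refine ⟨(ω ^ (2 * i) * a * z - a * w + ω ^ i * a ^ 2 * t) ^ p ^ e, ?_⟩
  simp only [← iterateFrobenius_def p e, ← map_pow, ← map_mul, ← map_add, coline]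

variable [IsDomain A]

/-- The syzygies of the `q`-th powers of `t⁴, wzt², w³t, w²z²`. -/
theorem exists_of_syzygy (h : IsCubicCone 𝒜 a b ω w z t) {n : ℕ} {α : Fin 4 → A}
    (hα : ∀ i, α i ∈ 𝒜 n)
    (hrel : α 0 * (t ^ p ^ e) ^ 4 + α 1 * (w ^ p ^ e * z ^ p ^ e * (t ^ p ^ e) ^ 2) +
      α 2 * ((w ^ p ^ e) ^ 3 * t ^ p ^ e) + α 3 * ((w ^ p ^ e) ^ 2 * (z ^ p ^ e) ^ 2) = 0) :
    ∃ γ : Fin 3 → A, (∀ i, γ i ∈ 𝒜 (n - p ^ e)) ∧ α 0 = b ^ p ^ e * w ^ p ^ e * γ 0 ∧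
      α 3 = t ^ p ^ e * γ 1 ∧ α 2 = w ^ p ^ e * γ 0 + z ^ p ^ e * γ 2 ∧
      ((∀ i, γ i = 0) → ∀ i, α i = 0) ∧
      ∀ i, t ^ p ^ e ∣ (γ 0 * (ω ^ p ^ e) ^ (2 * i) + γ 1 * (ω ^ p ^ e) ^ i + γ 2) *
        coline a ω w z t i ^ p ^ e := by
  have hr := h.relation_frobenius p e
  have hW0 : w ^ p ^ e ≠ 0 := pow_ne_zero _ h.w_ne_zero
  have hZ0 : z ^ p ^ e ≠ 0 := pow_ne_zero _ h.z_ne_zero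
  have hT0 : t ^ p ^ e ≠ 0 := pow_ne_zero _ h.t_ne_zero
  have hWm := h.pow_mem_one h.w_mem (p ^ e)
  have hZm := h.pow_mem_one h.z_mem (p ^ e)
  have hTm := h.pow_mem_one h.t_mem (p ^ e)
  have hbm : b ^ p ^ e ∈ 𝒜 0 := by simpa using h.pow_mem h.b_mem (p ^ e)
  have htw : ∀ m x, t ^ p ^ e ∣ (w ^ p ^ e) ^ m * x → t ^ p ^ e ∣ x := fun m x hx => by
    rw [← pow_mul] at hx
    exact dvd_of_pow_dvd_pow_mul h.t_ne_zero h.t_w _ _ hx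
  have htz : ∀ m x, t ^ p ^ e ∣ (z ^ p ^ e) ^ m * x → t ^ p ^ e ∣ x := fun m x hx => by
    rw [← pow_mul] at hx
    exact dvd_of_pow_dvd_pow_mul h.t_ne_zero h.t_z _ _ hx
  have hwt : ∀ m x, w ^ p ^ e ∣ (t ^ p ^ e) ^ m * x → w ^ p ^ e ∣ x := fun m x hx => by
    rw [← pow_mul] at hx
    exact dvd_of_pow_dvd_pow_mul h.w_ne_zero h.w_t _ _ hx
  have hzw : ∀ m x, z ^ p ^ e ∣ (w ^ p ^ e) ^ m * x → z ^ p ^ e ∣ x := fun m x hx => by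
    rw [← pow_mul] at hx
    exact dvd_of_pow_dvd_pow_mul h.z_ne_zero h.z_w _ _ hx
  obtain ⟨v, hv⟩ := h.isUnit_b.pow (p ^ e)
  have hvv : (↑v⁻¹ : A) * b ^ p ^ e = 1 := by rw [← hv, Units.inv_mul]
  have hom : ((ω ^ p ^ e) ^ 3) = 1 := by
    rw [← pow_mul, mul_comm, pow_mul, h.omega_pow_three, one_pow]
  have hQ := fun i => coline_frobenius a ω w z t p e i
  generalize a ^ p ^ e = a' at *
  have hb0 : b ^ p ^ e ≠ 0 := pow_ne_zero _ h.isUnit_b.ne_zero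
  generalize b ^ p ^ e = b' at *
  generalize w ^ p ^ e = W at *
  generalize z ^ p ^ e = Z at *
  generalize t ^ p ^ e = T at *
  generalize ω ^ p ^ e = ρ at *
  obtain ⟨γ1, h3⟩ : T ∣ α 3 := by
    refine htw 2 _ (htz 2 _ ⟨-(α 0 * T ^ 3 + α 1 * (W * Z * T) + α 2 * W ^ 3), ?_⟩)
    linear_combination hrel
  have e1 : α 0 * T ^ 3 + α 1 * (W * Z * T) + α 2 * W ^ 3 + γ1 * (W ^ 2 * Z ^ 2) = 0 := by
    refine mul_left_cancel₀ hT0 ?_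
    linear_combination hrel - W ^ 2 * Z ^ 2 * h3
  obtain ⟨δ, h0⟩ : W ∣ α 0 := by
    refine hwt 3 _ ⟨-(α 1 * (Z * T) + α 2 * W ^ 2 + γ1 * (W * Z ^ 2)), ?_⟩
    linear_combination e1
  obtain ⟨γ0, hδ⟩ : ∃ γ0, δ = b' * γ0 := ⟨↑v⁻¹ * δ, by linear_combination -δ * hvv⟩
  rw [hδ] at h0
  clear hδ
  have e2 : b' * γ0 * T ^ 3 + α 1 * (Z * T) + α 2 * W ^ 2 + γ1 * (W * Z ^ 2) = 0 := by
    refine mul_left_cancel₀ hW0 ?_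
    linear_combination e1 - T ^ 3 * h0
  obtain ⟨γ2, h2⟩ : Z ∣ α 2 - W * γ0 := by
    refine hzw 2 _ ⟨-(γ0 * Z ^ 2 - γ0 * 3 * a' * W * T + α 1 * T + γ1 * (W * Z)), ?_⟩
    linear_combination e2 + γ0 * hr
  have e3 : γ0 * (Z ^ 2 - 3 * a' * W * T) + α 1 * T + W ^ 2 * γ2 + γ1 * (W * Z) = 0 := by
    refine mul_left_cancel₀ hZ0 ?_
    linear_combination e2 + γ0 * hr - W ^ 2 * h2
  have m0 : W * γ0 ∈ 𝒜 n := by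
    have := h.div_mem hb0 hbm (y := W * γ0) (n := n)
      (by rw [← mul_assoc, mul_assoc, mul_left_comm, ← h0]; exact hα 0)
    simpa using this
  refine ⟨![γ0, γ1, γ2], ?_, ?_, h3, ?_, ?_, ?_⟩
  · intro i
    fin_cases i
    · exact h.div_mem hW0 hWm m0
    · exact h.div_mem hT0 hTm (h3 ▸ hα 3)
    · exact h.div_mem hZ0 hZm (h2 ▸ sub_mem (hα 2) m0)
  · simpa [mul_comm, mul_assoc, mul_left_comm] using h0
  · show α 2 = W * γ0 + Z * γ2
    linear_combination h2
  · intro hz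
    have z0 : γ0 = 0 := hz 0
    have z1 : γ1 = 0 := hz 1
    have z2 : γ2 = 0 := hz 2
    subst z0 z1 z2
    have : α 1 = 0 := (mul_eq_zero.1 (by linear_combination e3 : α 1 * T = 0)).resolve_right hT0
    have h2' : α 2 = 0 := by linear_combination h2
    intro i
    fin_cases i
    · simpa using h0
    · exact this
    · exact h2'
    · simpa using h3
  · intro i
    show T ∣ (γ0 * ρ ^ (2 * i) + γ1 * ρ ^ i + γ2) * _
    obtain ⟨y, hy⟩ := hQ i
    rw [hy]
    have hi : (ρ ^ i) ^ 3 = 1 := by rw [← pow_mul, mul_comm, pow_mul, hom, one_pow]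
    rw [mul_comm 2 i, pow_mul]
    generalize ρ ^ i = ζ at *
    rw [mul_add]
    refine dvd_add ?_ (Dvd.intro_left _ (by ring : (γ0 * ζ ^ 2 + γ1 * ζ + γ2) * y * T = _))
    refine htw 2 _ ⟨-α 1 * (Z ^ 2 + ζ * W * Z + ζ ^ 2 * W ^ 2) +
      3 * a' * γ0 * W * (Z ^ 2 + ζ * W * Z + ζ ^ 2 * W ^ 2) -
      (γ0 * (ζ * W + Z) + γ1 * W) * (3 * a' * W * Z + b' * T ^ 2), ?_⟩
    linear_combination (Z ^ 2 + ζ * W * Z + ζ ^ 2 * W ^ 2) * e3 -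
      (γ0 * (ζ * W + Z) + γ1 * W) * hr + (γ0 * (ζ * W + Z) + γ1 * W) * W ^ 3 * hi

omit [Fact p.Prime] [CharP A p] in
theorem eq_zero_of_vandermonde {ρ : A} (h3 : (3 : A) ≠ 0) (hρ : ρ ^ 2 + ρ + 1 = 0) {γ : Fin 3 → A}
    (h : ∀ i < 3, γ 0 * ρ ^ (2 * i) + γ 1 * ρ ^ i + γ 2 = 0) : ∀ i, γ i = 0 := by
  have h0 := h 0 (by norm_num)
  have h1 := h 1 (by norm_num)
  have h2 := h 2 (by norm_num)
  simp only [mul_zero, pow_zero, mul_one, Nat.reduceMul, pow_one] at h0 h1 h2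
  have hρ3 : ρ ^ 3 = 1 := by linear_combination (ρ - 1) * hρ
  intro i
  refine (mul_eq_zero.1 (?_ : 3 * γ i = 0)).resolve_left h3
  fin_cases i
  · show 3 * γ 0 = 0
    linear_combination h0 + ρ * h1 + ρ ^ 2 * h2 - (γ 0 * (ρ ^ 3 + 2) + γ 1 * ρ) * hρ3 -
      (γ 1 + γ 2) * hρ
  · show 3 * γ 1 = 0
    linear_combination h0 + ρ ^ 2 * h1 + ρ * h2 - (γ 0 * (ρ + ρ ^ 2) + γ 1 * 2) * hρ3 -
      (γ 0 + γ 2) * hρ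
  · show 3 * γ 2 = 0
    linear_combination h0 + h1 + h2 - (γ 0 * ρ) * hρ3 - (γ 0 + γ 1) * hρ

/-- The `q`-th powers of `t⁴, wzt², w³t, w²z²` have no syzygies of degree less than `4q/3`. -/
theorem syzygy_eq_zero (h : IsCubicCone 𝒜 a b ω w z t) {n : ℕ} (hn : 3 * n < 4 * p ^ e)
    {α : Fin 4 → A} (hα : ∀ i, α i ∈ 𝒜 n)
    (hrel : α 0 * (t ^ p ^ e) ^ 4 + α 1 * (w ^ p ^ e * z ^ p ^ e * (t ^ p ^ e) ^ 2) +
      α 2 * ((w ^ p ^ e) ^ 3 * t ^ p ^ e) + α 3 * ((w ^ p ^ e) ^ 2 * (z ^ p ^ e) ^ 2) = 0)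
    (i : Fin 4) :
    α i = 0 := by
  obtain ⟨γ, hγ, -, -, -, h0, hdvd⟩ := h.exists_of_syzygy p e hα hrel
  refine h0 (eq_zero_of_vandermonde h.three_ne_zero (h.omega_frobenius p e) fun i _ => ?_) i
  refine h.eq_zero_of_three_mul_lt (m := n - p ^ e) ?_ ?_ (hdvd i)
  · have hρ : ∀ m, (ω ^ p ^ e) ^ m ∈ 𝒜 0 := fun m => by
      rw [← pow_mul]; exact h.omega_pow_mem _
    refine add_mem (add_mem ?_ ?_) (hγ 2)
    · rw [mul_comm]; exact h.zero_mul_mem (hρ _) (hγ 0)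
    · rw [mul_comm]; exact h.zero_mul_mem (hρ _) (hγ 1)
  · have := Nat.pow_pos (n := e) (Fact.out : p.Prime).pos
    omega

/-- An alternating matrix of degree less than `8q/3` all of whose rows are syzygies of the `q`-th
powers of `t⁴, wzt², w³t, w²z²` vanishes. -/
theorem alternating_syzygy_eq_zero (h : IsCubicCone 𝒜 a b ω w z t) {n : ℕ}
    (hn : 3 * n < 8 * p ^ e) {β : Fin 4 → Fin 4 → A} (hβ : ∀ i j, β i j ∈ 𝒜 n)
    (hdiag : ∀ i, β i i = 0) (hanti : ∀ i j, β i j = -β j i)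
    (hrel : ∀ i, β i 0 * (t ^ p ^ e) ^ 4 + β i 1 * (w ^ p ^ e * z ^ p ^ e * (t ^ p ^ e) ^ 2) +
      β i 2 * ((w ^ p ^ e) ^ 3 * t ^ p ^ e) + β i 3 * ((w ^ p ^ e) ^ 2 * (z ^ p ^ e) ^ 2) = 0)
    (i j : Fin 4) : β i j = 0 := by
  choose γ hγ hγ0 hγ1 hγ2 hγz hγd using fun i => h.exists_of_syzygy p e (hβ i) (hrel i)
  have hW0 : w ^ p ^ e ≠ 0 := pow_ne_zero _ h.w_ne_zero
  have hZ0 : z ^ p ^ e ≠ 0 := pow_ne_zero _ h.z_ne_zero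
  have hT0 : t ^ p ^ e ≠ 0 := pow_ne_zero _ h.t_ne_zero
  have hb0 : b ^ p ^ e ≠ 0 := pow_ne_zero _ h.isUnit_b.ne_zero
  have hγrel : ∀ k, γ 0 k * (t ^ p ^ e) ^ 4 +
      γ 1 k * (w ^ p ^ e * z ^ p ^ e * (t ^ p ^ e) ^ 2) +
      γ 2 k * ((w ^ p ^ e) ^ 3 * t ^ p ^ e) + γ 3 k * ((w ^ p ^ e) ^ 2 * (z ^ p ^ e) ^ 2) = 0 := by
    have r0 : γ 0 0 * (t ^ p ^ e) ^ 4 +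
        γ 1 0 * (w ^ p ^ e * z ^ p ^ e * (t ^ p ^ e) ^ 2) +
        γ 2 0 * ((w ^ p ^ e) ^ 3 * t ^ p ^ e) +
        γ 3 0 * ((w ^ p ^ e) ^ 2 * (z ^ p ^ e) ^ 2) = 0 := by
      refine mul_left_cancel₀ (mul_ne_zero hb0 hW0) ?_
      have := hrel 0
      rw [hanti 0 0, hanti 0 1, hanti 0 2, hanti 0 3, hγ0, hγ0, hγ0, hγ0] at this
      linear_combination -this
    have r1 : γ 0 1 * (t ^ p ^ e) ^ 4 +
        γ 1 1 * (w ^ p ^ e * z ^ p ^ e * (t ^ p ^ e) ^ 2) +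
        γ 2 1 * ((w ^ p ^ e) ^ 3 * t ^ p ^ e) +
        γ 3 1 * ((w ^ p ^ e) ^ 2 * (z ^ p ^ e) ^ 2) = 0 := by
      refine mul_left_cancel₀ hT0 ?_
      have := hrel 3
      rw [hanti 3 0, hanti 3 1, hanti 3 2, hanti 3 3, hγ1, hγ1, hγ1, hγ1] at this
      linear_combination -this
    intro k
    fin_cases k
    · exact r0
    · exact r1
    · refine mul_left_cancel₀ hZ0 ?_
      have := hrel 2
      rw [hanti 2 0, hanti 2 1, hanti 2 2, hanti 2 3, hγ2, hγ2, hγ2, hγ2] at this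
      simp only [Fin.reduceFinMk]
      linear_combination -this - w ^ p ^ e * r0
  choose ε hε hε0 hε1 hε2 hεz hεdvd using
    fun k => h.exists_of_syzygy p e (fun i => hγ i k) (hγrel k)
  have ε00 : ε 0 0 = 0 := by
    refine (mul_eq_zero.1 ?_).resolve_left (mul_ne_zero (mul_ne_zero hb0 hW0) (mul_ne_zero hb0 hW0))
    linear_combination -hγ0 0 - b ^ p ^ e * w ^ p ^ e * hε0 0 + hdiag 0
  have ε11 : ε 1 1 = 0 := by
    refine (mul_eq_zero.1 ?_).resolve_left (mul_ne_zero hT0 hT0)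
    linear_combination -hγ1 3 - t ^ p ^ e * hε1 1 + hdiag 3
  have ε01 : ε 0 1 = -ε 1 0 := by
    refine mul_left_cancel₀ (mul_ne_zero (mul_ne_zero hb0 hW0) hT0) ?_
    linear_combination -hγ0 3 - b ^ p ^ e * w ^ p ^ e * hε1 0 + hanti 3 0 - hγ1 0 -
      t ^ p ^ e * hε0 1
  have ε02 : ε 0 2 = -ε 2 0 := by
    refine mul_left_cancel₀ (mul_ne_zero (mul_ne_zero hb0 hW0) hZ0) ?_
    linear_combination -hγ0 2 - b ^ p ^ e * w ^ p ^ e * hε2 0 + hanti 2 0 - hγ2 0 -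
      z ^ p ^ e * hε0 2 - w ^ p ^ e * hε0 0 - 2 * b ^ p ^ e * (w ^ p ^ e) ^ 2 * ε00
  have ε12 : ε 1 2 = -ε 2 1 := by
    refine mul_left_cancel₀ (mul_ne_zero hT0 hZ0) ?_
    linear_combination -hγ1 2 - t ^ p ^ e * hε2 1 + hanti 2 3 - hγ2 3 -
      z ^ p ^ e * hε1 2 - w ^ p ^ e * hε1 0 - w ^ p ^ e * t ^ p ^ e * ε01
  have ε22 : ε 2 2 = 0 := by
    refine (mul_eq_zero.1 ?_).resolve_left (mul_ne_zero hZ0 hZ0)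
    linear_combination -hγ2 2 - z ^ p ^ e * hε2 2 + hdiag 2 - w ^ p ^ e * hε2 0 -
      (w ^ p ^ e) ^ 2 * ε00 - w ^ p ^ e * z ^ p ^ e * ε02
  set ρ := ω ^ p ^ e with hρdef
  have hρ : ∀ m, ρ ^ m ∈ 𝒜 0 := fun m => by
    rw [← pow_mul]; exact h.omega_pow_mem _
  have hρ1 := h.omega_frobenius p e
  have hεp : ∀ i < 3, ∀ j < 3, ((ε 0 0 * ρ ^ (2 * j) + ε 0 1 * ρ ^ j + ε 0 2) * ρ ^ (2 * i) +
      (ε 1 0 * ρ ^ (2 * j) + ε 1 1 * ρ ^ j + ε 1 2) * ρ ^ i +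
      (ε 2 0 * ρ ^ (2 * j) + ε 2 1 * ρ ^ j + ε 2 2)) = 0 := by
    have hdvd : ∀ i j, t ^ p ^ e ∣ ((ε 0 0 * ρ ^ (2 * j) + ε 0 1 * ρ ^ j + ε 0 2) * ρ ^ (2 * i) +
        (ε 1 0 * ρ ^ (2 * j) + ε 1 1 * ρ ^ j + ε 1 2) * ρ ^ i +
        (ε 2 0 * ρ ^ (2 * j) + ε 2 1 * ρ ^ j + ε 2 2)) * coline a ω w z t j ^ p ^ e := by
      intro i j
      obtain ⟨y0, h0⟩ := hεdvd 0 j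
      obtain ⟨y1, h1⟩ := hεdvd 1 j
      obtain ⟨y2, h2⟩ := hεdvd 2 j
      exact ⟨y0 * ρ ^ (2 * i) + y1 * ρ ^ i + y2, by
        linear_combination ρ ^ (2 * i) * h0 + ρ ^ i * h1 + h2⟩
    have hmem : ∀ k j, ε k 0 * ρ ^ (2 * j) + ε k 1 * ρ ^ j + ε k 2 ∈ 𝒜 (n - p ^ e - p ^ e) := by
      intro k j
      refine add_mem (add_mem ?_ ?_) (hε k 2)
      · rw [mul_comm]; exact h.zero_mul_mem (hρ _) (hε k 0)
      · rw [mul_comm]; exact h.zero_mul_mem (hρ _) (hε k 1)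
    have key : ∀ i j, j = i + 1 ∨ j = i + 2 →
        ((ε 0 0 * ρ ^ (2 * j) + ε 0 1 * ρ ^ j + ε 0 2) * ρ ^ (2 * i) +
        (ε 1 0 * ρ ^ (2 * j) + ε 1 1 * ρ ^ j + ε 1 2) * ρ ^ i +
        (ε 2 0 * ρ ^ (2 * j) + ε 2 1 * ρ ^ j + ε 2 2)) = 0 := by
      intro i j hij
      refine h.eq_zero_of_three_mul_lt_two_mul (m := n - p ^ e - p ^ e) hij ?_ ?_ ?_ (hdvd i j)
      · refine add_mem (add_mem ?_ ?_) (hmem 2 j)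
        · rw [mul_comm]; exact h.zero_mul_mem (hρ _) (hmem 0 j)
        · rw [mul_comm]; exact h.zero_mul_mem (hρ _) (hmem 1 j)
      · have := Nat.pow_pos (n := e) (Fact.out : p.Prime).pos
        omega
      · convert (dvd_neg (α := A)).2 (hdvd j i) using 1
        rw [ε00, ε11, ε22, ε01, ε02, ε12]
        ring
    intro i hi j hj
    rcases lt_trichotomy i j with hij | rfl | hij
    · exact key i j (by omega)
    · rw [ε00, ε11, ε22, ε01, ε02, ε12]
      ring
    · have := key j i (by omega)
      rw [ε00, ε11, ε22, ε01, ε02, ε12] at this ⊢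
      linear_combination -this
  have hεz' : ∀ k l, ε k l = 0 := by
    intro k
    refine eq_zero_of_vandermonde h.three_ne_zero hρ1 fun j hj => ?_
    exact eq_zero_of_vandermonde h.three_ne_zero hρ1
      (γ := fun k => ε k 0 * ρ ^ (2 * j) + ε k 1 * ρ ^ j + ε k 2) (fun i hi => hεp i hi j hj) k
  exact hγz i (fun k => hεz k (hεz' k) i) j

end Frobenius

end IsCubicCone

section CubicRing

variable {k : Type*} [Field k] (a b : k)

/-- The cubic form `z³ - w³ - 3awzt - bt³` in the variables `z, w, t`. -/
noncomputable def thetaCubic : MvPolynomial (Fin 3) k :=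
  X 0 ^ 3 - X 1 ^ 3 - C (3 * a) * X 1 * X 0 * X 2 - C b * X 2 ^ 3

theorem thetaCubic_isHomogeneous : (thetaCubic a b).IsHomogeneous 3 := by
  refine ((((isHomogeneous_X k 0).pow 3).sub ((isHomogeneous_X k 1).pow 3)).sub ?_).sub ?_
  · exact (((isHomogeneous_C _ (3 * a)).mul (isHomogeneous_X k 1)).mul (isHomogeneous_X k 0)).mul
      (isHomogeneous_X k 2)
  · exact (isHomogeneous_C _ b).mul ((isHomogeneous_X k 2).pow 3)

variable {a b}

theorem not_exists_root_of_thetaCubic (h3 : (3 : k) ≠ 0) (hab : b - a ^ 3 ≠ 0)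
    (ρ : Polynomial k) :
    ρ ^ 3 ≠ Polynomial.C (3 * a) * Polynomial.X * ρ + 1 + Polynomial.C b * Polynomial.X ^ 3 := by
  intro h
  have hd : ρ.natDegree ≤ 1 := by
    by_contra! hd
    have h1 : (ρ ^ 3).natDegree ≤ max (ρ.natDegree + 1) 3 := by
      rw [h]
      refine (Polynomial.natDegree_add_le _ _).trans
        (max_le ((Polynomial.natDegree_add_le _ _).trans (max_le ?_ ?_)) ?_)
      · refine Polynomial.natDegree_mul_le.trans (le_max_of_le_left ?_)
        have : (Polynomial.C (3 * a) * Polynomial.X).natDegree ≤ 1 := by compute_degree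
        omega
      · simp
      · exact (Polynomial.natDegree_C_mul_X_pow_le _ _).trans (le_max_right _ _)
    rw [Polynomial.natDegree_pow] at h1
    omega
  obtain ⟨β, α, rfl⟩ := Polynomial.exists_eq_X_add_C_of_natDegree_le_one hd
  have h2 : Polynomial.C (β ^ 3 - b) * Polynomial.X ^ 3 +
      Polynomial.C (3 * (α * β ^ 2 - a * β)) * Polynomial.X ^ 2 +
      Polynomial.C (3 * (α ^ 2 * β - a * α)) * Polynomial.X + Polynomial.C (α ^ 3 - 1) = 0 := by
    simp only [map_sub, map_mul, map_pow, map_ofNat, map_one] at h ⊢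
    linear_combination h
  have key : ∀ c₃ c₂ c₁ c₀ : k, Polynomial.C c₃ * Polynomial.X ^ 3 +
      Polynomial.C c₂ * Polynomial.X ^ 2 + Polynomial.C c₁ * Polynomial.X + Polynomial.C c₀ = 0 →
      c₃ = 0 ∧ c₁ = 0 ∧ c₀ = 0 := by
    intro c₃ c₂ c₁ c₀ hc
    have c0 := congrArg (Polynomial.coeff · 0) hc
    have c1 := congrArg (Polynomial.coeff · 1) hc
    have c3 := congrArg (Polynomial.coeff · 3) hc
    simp [Polynomial.coeff_X, Polynomial.coeff_C, Polynomial.coeff_X_pow] at c0 c1 c3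
    exact ⟨c3, c1, c0⟩
  obtain ⟨c3, c1, c0⟩ := key _ _ _ _ h2
  replace c1 := (mul_eq_zero.1 c1).resolve_left h3
  have hα : α ≠ 0 := by rintro rfl; simp at c0
  have e1 : α * β = a := mul_left_cancel₀ hα (by linear_combination c1)
  exact hab (by linear_combination -c3 - β ^ 3 * c0 + (a ^ 2 + a * α * β + α ^ 2 * β ^ 2) * e1)

theorem thetaCubic_irreducible (h3 : (3 : k) ≠ 0) (hab : b - a ^ 3 ≠ 0) :
    Irreducible (thetaCubic a b) := by
  rw [← MulEquiv.irreducible_iff (finSuccEquiv k 2)]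
  have he : finSuccEquiv k 2 (thetaCubic a b) =
      Polynomial.X ^ 3 - Polynomial.C (C (3 * a) * X 0 * X 1) * Polynomial.X -
        Polynomial.C (X 0 ^ 3 + C b * X 1 ^ 3) := by
    have e1 : finSuccEquiv k 2 (X 1) = Polynomial.C (X 0) := finSuccEquiv_X_succ (j := 0)
    have e2 : finSuccEquiv k 2 (X 2) = Polynomial.C (X 1) := finSuccEquiv_X_succ (j := 1)
    have e3 : ∀ c, finSuccEquiv k 2 (C c) = Polynomial.C (C c) := fun c => by
      simp [finSuccEquiv_apply]
    simp only [thetaCubic, map_sub, map_mul, map_pow, finSuccEquiv_X_zero, e1, e2, e3, map_add]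
    ring
  have hdeg : (Polynomial.C (C (3 * a) * X 0 * X 1) * Polynomial.X +
        Polynomial.C (X 0 ^ 3 + C b * X 1 ^ 3) :
        Polynomial (MvPolynomial (Fin 2) k)).degree < (3 : ℕ) :=
    Polynomial.degree_linear_lt.trans_le (by norm_num)
  rw [he, sub_sub]
  have hnat : (Polynomial.X ^ 3 - (Polynomial.C (C (3 * a) * X 0 * X 1) * Polynomial.X +
        Polynomial.C (X 0 ^ 3 + C b * X 1 ^ 3)) :
        Polynomial (MvPolynomial (Fin 2) k)).natDegree = 3 := by
    compute_degree!
  rw [Polynomial.Monic.irreducible_iff_roots_eq_zero_of_degree_le_three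
    (Polynomial.monic_X_pow_sub hdeg)]
  · refine Multiset.eq_zero_of_forall_notMem fun r hr => ?_
    have hr := Polynomial.isRoot_of_mem_roots hr
    refine not_exists_root_of_thetaCubic h3 hab (aeval ![1, Polynomial.X] r) ?_
    have := congrArg (aeval (R := k) ![(1 : Polynomial k), Polynomial.X]) hr.eq_zero
    simp only [Polynomial.eval_sub, Polynomial.eval_add, Polynomial.eval_mul, Polynomial.eval_pow,
      Polynomial.eval_X, Polynomial.eval_C, map_sub, map_add, map_mul, map_pow, map_zero, aeval_X,
      algHom_C, Polynomial.algebraMap_eq, Matrix.cons_val_zero, Matrix.cons_val_one] at this ⊢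
    linear_combination this
  · rw [hnat]; norm_num
  · rw [hnat]

variable (a b) in
/-- The coordinate ring of the plane cubic `z³ = w³ + 3awzt + bt³`. -/
abbrev ThetaRing : Type _ := MvPolynomial (Fin 3) k ⧸ Ideal.span {thetaCubic a b}

theorem ThetaRing.isDomain (h3 : (3 : k) ≠ 0) (hab : b - a ^ 3 ≠ 0) :
    IsDomain (ThetaRing a b) := by
  have hirr := thetaCubic_irreducible h3 hab
  have := (Ideal.span_singleton_prime hirr.ne_zero).2 hirr.prime
  exact Ideal.Quotient.isDomain _

variable (a b) in
/-- The homogeneous elements of degree `n`. -/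
noncomputable def ThetaRing.deg (n : ℕ) : AddSubgroup (ThetaRing a b) :=
  (homogeneousSubmodule (Fin 3) k n).toAddSubgroup.map
    (Ideal.Quotient.mk (Ideal.span {thetaCubic a b})).toAddMonoidHom

theorem ThetaRing.mem_deg {n : ℕ} {x : ThetaRing a b} : x ∈ ThetaRing.deg a b n ↔
    ∃ s : MvPolynomial (Fin 3) k, s.IsHomogeneous n ∧ Ideal.Quotient.mk _ s = x := by
  simp [ThetaRing.deg]

theorem dvd_sub_aeval {σ : Type*} {u : MvPolynomial σ k} {g : σ → MvPolynomial σ k}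
    (h : ∀ i, u ∣ X i - g i) (s : MvPolynomial σ k) : u ∣ s - aeval g s := by
  induction s using MvPolynomial.induction_on with
  | C c => simp
  | add x y hx hy =>
    rw [map_add, add_sub_add_comm]
    exact dvd_add hx hy
  | mul_X x i hx =>
    rw [map_mul, aeval_X]
    have : x * X i - aeval g x * g i = (x - aeval g x) * X i + aeval g x * (X i - g i) := by ring
    rw [this]
    exact dvd_add (hx.mul_right _) ((h i).mul_left _)

theorem ThetaRing.dvd_of_dvd_mul {u v : MvPolynomial (Fin 3) k}
    {g : Fin 3 → MvPolynomial (Fin 3) k} (h : ∀ i, u ∣ X i - g i) (hu : aeval g u = 0)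
    (hv : IsRelPrime (aeval g (thetaCubic a b)) (aeval g v)) (x : ThetaRing a b)
    (hx : Ideal.Quotient.mk _ u ∣ Ideal.Quotient.mk _ v * x) : Ideal.Quotient.mk _ u ∣ x := by
  obtain ⟨s, rfl⟩ := Ideal.Quotient.mk_surjective x
  obtain ⟨y, hy⟩ := hx
  obtain ⟨r, rfl⟩ := Ideal.Quotient.mk_surjective y
  rw [← map_mul, ← map_mul, Ideal.Quotient.eq, Ideal.mem_span_singleton] at hy
  obtain ⟨m, hm⟩ := hy
  have h1 := congrArg (aeval g) hm
  simp only [map_sub, map_mul, hu, zero_mul, sub_zero] at h1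
  obtain ⟨n, hn⟩ := hv.dvd_of_dvd_mul_left ⟨_, h1⟩
  obtain ⟨s', hs'⟩ := dvd_sub_aeval h s
  obtain ⟨c', hc'⟩ := dvd_sub_aeval h (thetaCubic a b)
  refine ⟨Ideal.Quotient.mk _ (s' - c' * n), ?_⟩
  rw [← map_mul, Ideal.Quotient.eq, Ideal.mem_span_singleton]
  exact ⟨n, by linear_combination hs' + hn - n * hc'⟩

theorem not_X_dvd_of_eval_ne_zero {σ : Type*} {i : σ} {f : MvPolynomial σ k} {x : σ → k}
    (hx : x i = 0) (hf : eval x f ≠ 0) : ¬ X i ∣ f := by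
  rintro ⟨y, rfl⟩
  simp [hx] at hf

theorem isRelPrime_X_of_eval_ne_zero {σ : Type*} {i : σ} {f : MvPolynomial σ k} (x : σ → k)
    (hx : x i = 0) (hf : eval x f ≠ 0) : IsRelPrime (X i) f :=
  (X_prime (R := k) (σ := σ)).irreducible.isRelPrime_iff_not_dvd.2 (not_X_dvd_of_eval_ne_zero hx hf)

namespace ThetaRing

theorem mk_mem_deg {n : ℕ} {s : MvPolynomial (Fin 3) k} (hs : s.IsHomogeneous n) :
    Ideal.Quotient.mk (Ideal.span {thetaCubic a b}) s ∈ deg a b n :=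
  mem_deg.2 ⟨s, hs, rfl⟩

theorem exists_eq_mul_of_mul_mem_deg {m n : ℕ} {u y : ThetaRing a b} (hu : u ∈ deg a b m)
    (hy : u * y ∈ deg a b n) :
    ∃ y' ∈ deg a b (n - m), (n < m → y' = 0) ∧ u * y = u * y' := by
  obtain ⟨u, hu', rfl⟩ := mem_deg.1 hu
  obtain ⟨x, hx, hxy⟩ := mem_deg.1 hy
  obtain ⟨y, rfl⟩ := Ideal.Quotient.mk_surjective y
  rw [← map_mul, Ideal.Quotient.eq] at hxy
  obtain ⟨y', h1, h2, h3⟩ := hx.exists_coeffs (ι := Unit) (s := {thetaCubic a b})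
    (u := fun _ => u) (y := fun _ => y) (by rintro _ rfl; exact ⟨3, thetaCubic_isHomogeneous a b⟩)
    (fun _ => hu') (by simpa using hxy)
  refine ⟨_, mk_mem_deg (h1 ()), fun h => by rw [h2 h, map_zero], ?_⟩
  rw [← map_mul, ← map_mul, Ideal.Quotient.eq]
  have := Ideal.sub_mem _ h3 hxy
  simpa using this

theorem mk_ne_zero_of_eval (x : Fin 3 → k) (s : MvPolynomial (Fin 3) k)
    (hx : eval x (thetaCubic a b) = 0) (hs : eval x s ≠ 0) :
    Ideal.Quotient.mk (Ideal.span {thetaCubic a b}) s ≠ 0 := by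
  intro h
  rw [Ideal.Quotient.eq_zero_iff_mem, Ideal.mem_span_singleton] at h
  obtain ⟨y, rfl⟩ := h
  simp [hx] at hs

theorem line_dvd {ζ η : k} (hζ : ζ ^ 3 = 1) (h : ζ ≠ η) (hab : b - a ^ 3 ≠ 0)
    (x : ThetaRing a b)
    (hx : Ideal.Quotient.mk _ (X 0 - C ζ * X 1 - C (ζ ^ 2 * a) * X 2) ∣
      Ideal.Quotient.mk _ (X 0 - C η * X 1 - C (η ^ 2 * a) * X 2) * x) :
    Ideal.Quotient.mk _ (X 0 - C ζ * X 1 - C (ζ ^ 2 * a) * X 2) ∣ x := by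
  refine dvd_of_dvd_mul (g := ![C ζ * X 1 + C (ζ ^ 2 * a) * X 2, X 1, X 2]) ?_ ?_ ?_ x hx
  · intro i
    fin_cases i
    · simp [sub_sub]
    · simp
    · simp
  · simp
  · have e : aeval ![C ζ * X 1 + C (ζ ^ 2 * a) * X 2, X 1, X 2] (thetaCubic a b) =
        (C (a ^ 3 - b) * X 2 ^ 3 : MvPolynomial (Fin 3) k) := by
      have hz : (C ζ : MvPolynomial (Fin 3) k) ^ 3 = 1 := by rw [← C_pow, hζ, C_1]
      simp only [thetaCubic, map_sub, map_mul, map_pow, aeval_X, Matrix.cons_val, map_ofNat,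
        algHom_C, algebraMap_eq]
      linear_combination (X 1 ^ 3 + 3 * C a * C ζ * X 2 * X 1 ^ 2 +
        3 * C a ^ 2 * C ζ ^ 2 * X 1 * X 2 ^ 2 + C a ^ 3 * (C ζ ^ 3 + 1) * X 2 ^ 3) * hz
    rw [e]
    have hu : IsUnit (C (a ^ 3 - b) : MvPolynomial (Fin 3) k) :=
      (IsUnit.mk0 _ (fun h' => hab (by linear_combination -h'))).map C
    rw [isRelPrime_mul_unit_left_left hu]
    refine IsRelPrime.pow_left (isRelPrime_X_of_eval_ne_zero ![0, 1, 0] rfl ?_)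
    simpa [sub_eq_zero] using h

variable [IsAlgClosed k]

theorem isCubicCone (h3 : (3 : k) ≠ 0) (hab : b - a ^ 3 ≠ 0) (hb : b ≠ 0) {ω : k}
    (hω : ω ^ 2 + ω + 1 = 0) :
    IsCubicCone (deg a b) (algebraMap k (ThetaRing a b) a) (algebraMap k _ b) (algebraMap k _ ω)
      (Ideal.Quotient.mk _ (X 1)) (Ideal.Quotient.mk _ (X 0)) (Ideal.Quotient.mk _ (X 2)) := by
  have := isDomain h3 hab
  have hω3 : ω ^ 3 = 1 := by linear_combination (ω - 1) * hω
  have hC : ∀ c, algebraMap k (ThetaRing a b) c = Ideal.Quotient.mk _ (C c) := fun c => rfl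
  have hω1 : ω ≠ 1 := by rintro rfl; exact h3 (by linear_combination hω)
  have hω0 : ω ≠ 0 := by rintro rfl; simp at hω
  have hline : ∀ (i j : ℕ), ω ^ j ≠ 1 → ∀ x : ThetaRing a b,
      Ideal.Quotient.mk _ (X 0) - algebraMap k _ ω ^ i * Ideal.Quotient.mk _ (X 1) -
        algebraMap k _ ω ^ (2 * i) * algebraMap k _ a * Ideal.Quotient.mk _ (X 2) ∣
      (Ideal.Quotient.mk _ (X 0) - algebraMap k _ ω ^ (i + j) * Ideal.Quotient.mk _ (X 1) -
        algebraMap k _ ω ^ (2 * (i + j)) * algebraMap k _ a * Ideal.Quotient.mk _ (X 2)) * x →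
      Ideal.Quotient.mk _ (X 0) - algebraMap k _ ω ^ i * Ideal.Quotient.mk _ (X 1) -
        algebraMap k _ ω ^ (2 * i) * algebraMap k _ a * Ideal.Quotient.mk _ (X 2) ∣ x := by
    intro i j hj x hx
    have e : ∀ i, (Ideal.Quotient.mk _ (X 0) - algebraMap k _ ω ^ i * Ideal.Quotient.mk _ (X 1) -
        algebraMap k _ ω ^ (2 * i) * algebraMap k _ a * Ideal.Quotient.mk _ (X 2) :
          ThetaRing a b) =
        Ideal.Quotient.mk _ (X 0 - C (ω ^ i) * X 1 - C ((ω ^ i) ^ 2 * a) * X 2) := fun i => by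
      simp only [hC, map_sub, map_mul, map_pow]
      ring
    rw [e, e] at hx
    rw [e]
    refine line_dvd ?_ ?_ hab x hx
    · rw [← pow_mul, mul_comm, pow_mul, hω3, one_pow]
    · intro h
      apply hj
      rw [pow_add] at h
      exact mul_left_cancel₀ (pow_ne_zero i hω0) (by rw [mul_one, ← h])
  constructor
  case mul_mem =>
    rintro m n x y hx hy
    obtain ⟨r, hr, rfl⟩ := mem_deg.1 hx
    obtain ⟨s, hs, rfl⟩ := mem_deg.1 hy
    rw [← map_mul]
    exact mk_mem_deg (hr.mul hs)
  case one_mem => exact mk_mem_deg (isHomogeneous_one _ _)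
  case div_mem =>
    intro m n u y hu0 hu hy
    obtain ⟨y', h1, -, h2⟩ := exists_eq_mul_of_mul_mem_deg hu hy
    rwa [mul_left_cancel₀ hu0 h2]
  case eq_zero =>
    intro m n u y hu hy hnm
    obtain ⟨y', -, h1, h2⟩ := exists_eq_mul_of_mul_mem_deg hu hy
    rw [h2, h1 hnm, mul_zero]
  case a_mem => exact mk_mem_deg (isHomogeneous_C _ _)
  case b_mem => exact mk_mem_deg (isHomogeneous_C _ _)
  case omega_mem => exact mk_mem_deg (isHomogeneous_C _ _)
  case w_mem => exact mk_mem_deg (isHomogeneous_X _ _)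
  case z_mem => exact mk_mem_deg (isHomogeneous_X _ _)
  case t_mem => exact mk_mem_deg (isHomogeneous_X _ _)
  case relation =>
    have h : Ideal.Quotient.mk (Ideal.span {thetaCubic a b})
        (X 0 ^ 3 - X 1 ^ 3 - C (3 * a) * X 1 * X 0 * X 2 - C b * X 2 ^ 3) = 0 :=
      Ideal.Quotient.eq_zero_iff_mem.2 (Ideal.mem_span_singleton_self _)
    simp only [map_sub, map_mul, map_pow, map_ofNat] at h
    simp only [hC]
    linear_combination h
  case omega_eq =>
    rw [← map_pow, ← map_add, ← map_one (algebraMap k (ThetaRing a b)), ← map_add, hω, map_zero]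
  case isUnit_b => exact (IsUnit.mk0 b hb).map _
  case isUnit_kappa =>
    rw [← map_pow, ← map_sub]
    exact (IsUnit.mk0 _ hab).map _
  case three_ne_zero =>
    rw [← map_ofNat (algebraMap k (ThetaRing a b)) 3]
    exact (map_ne_zero_iff _ (algebraMap k (ThetaRing a b)).injective).2 h3
  case w_ne_zero => exact mk_ne_zero_of_eval ![1, 1, 0] _ (by simp [thetaCubic]) (by simp)
  case z_ne_zero => exact mk_ne_zero_of_eval ![1, 1, 0] _ (by simp [thetaCubic]) (by simp)
  case t_ne_zero =>
    obtain ⟨c, hc⟩ := IsAlgClosed.exists_pow_nat_eq b (n := 3) (by norm_num)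
    exact mk_ne_zero_of_eval ![c, 0, 1] _ (by simp [thetaCubic, hc]) (by simp)
  case t_w =>
    refine dvd_of_dvd_mul (g := ![X 0, X 1, 0]) ?_ (by simp) ?_
    · intro i; fin_cases i <;> simp
    · rw [aeval_X]
      exact (isRelPrime_X_of_eval_ne_zero ![1, 0, 0] (by simp) (by simp [thetaCubic])).symm
  case t_z =>
    refine dvd_of_dvd_mul (g := ![X 0, X 1, 0]) ?_ (by simp) ?_
    · intro i; fin_cases i <;> simp
    · rw [aeval_X]
      exact (isRelPrime_X_of_eval_ne_zero ![0, 1, 0] (by simp) (by simp [thetaCubic])).symm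
  case w_t =>
    refine dvd_of_dvd_mul (g := ![X 0, 0, X 2]) ?_ (by simp) ?_
    · intro i; fin_cases i <;> simp
    · rw [aeval_X]
      exact (isRelPrime_X_of_eval_ne_zero ![1, 0, 0] (by simp) (by simp [thetaCubic])).symm
  case z_w =>
    refine dvd_of_dvd_mul (g := ![0, X 1, X 2]) ?_ (by simp) ?_
    · intro i; fin_cases i <;> simp
    · rw [aeval_X]
      exact (isRelPrime_X_of_eval_ne_zero ![0, 0, 1] (by simp) (by simpa [thetaCubic])).symm
  case line_one => exact fun i => hline i 1 (by simpa using hω1)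
  case line_two =>
    refine fun i => hline i 2 fun h => hω1 ?_
    linear_combination hω3 - ω * h

end ThetaRing

end CubicRing

section NormalForm

variable {k : Type*} [Field k]

/-- The quadric cone `X₀X₃ = X₁²`. -/
noncomputable def conicForm (k : Type*) [Field k] : MvPolynomial (Fin 4) k := X 0 * X 3 - X 1 ^ 2

/-- The Weierstrass equation `y² + 3axy + by = x³` as a quadric in `ℙ³`, where the coordinates are
`1, x, y, x²`. -/
noncomputable def weierstrassForm (a b : k) : MvPolynomial (Fin 4) k :=
  X 2 ^ 2 + C (3 * a) * X 1 * X 2 + C b * X 0 * X 2 - X 1 * X 3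

theorem conicForm_isHomogeneous : (conicForm k).IsHomogeneous 2 :=
  ((isHomogeneous_X k 0).mul (isHomogeneous_X k 3)).sub ((isHomogeneous_X k 1).pow 2)

theorem weierstrassForm_isHomogeneous (a b : k) : (weierstrassForm a b).IsHomogeneous 2 :=
  ((((isHomogeneous_X k 2).pow 2).add (((isHomogeneous_C _ (3 * a)).mul (isHomogeneous_X k 1)).mul
    (isHomogeneous_X k 2))).add (((isHomogeneous_C _ b).mul (isHomogeneous_X k 0)).mul
    (isHomogeneous_X k 2))).sub ((isHomogeneous_X k 1).mul (isHomogeneous_X k 3))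

/-- The ideal of an elliptic quartic curve in normal form. -/
noncomputable def weierstrassIdeal (a b : k) : Ideal (MvPolynomial (Fin 4) k) :=
  Ideal.span {conicForm k, weierstrassForm a b}

theorem isHomogeneous_of_mem_weierstrassIdeal_gens (a b : k) :
    ∀ x ∈ ({conicForm k, weierstrassForm a b} : Set (MvPolynomial (Fin 4) k)),
      ∃ n, x.IsHomogeneous n := by
  rintro x (rfl | rfl)
  · exact ⟨2, conicForm_isHomogeneous⟩
  · exact ⟨2, weierstrassForm_isHomogeneous a b⟩

/-- The substitution embedding the elliptic quartic by sections supported on the flexes. -/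
noncomputable def thetaSubst (k : Type*) [Field k] :
    MvPolynomial (Fin 4) k →ₐ[k] MvPolynomial (Fin 3) k :=
  aeval ![X 2 ^ 4, X 1 * X 0 * X 2 ^ 2, X 1 ^ 3 * X 2, X 1 ^ 2 * X 0 ^ 2]

/-- The map from the polynomial ring to the coordinate ring of the plane cubic. -/
noncomputable def thetaMap (a b : k) : MvPolynomial (Fin 4) k →ₐ[k] ThetaRing a b :=
  (Ideal.Quotient.mkₐ k _).comp (thetaSubst k)

theorem thetaMap_eq_zero_of_mem {a b : k} {x : MvPolynomial (Fin 4) k}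
    (hx : x ∈ weierstrassIdeal a b) : thetaMap a b x = 0 := by
  have : weierstrassIdeal a b ≤ RingHom.ker (thetaMap a b) := by
    refine Ideal.span_le.2 ?_
    rintro x (rfl | rfl)
    · have : thetaSubst k (conicForm k) = 0 := by
        simp [thetaSubst, conicForm]
        ring
      simp [RingHom.mem_ker, thetaMap, this]
    · have : thetaSubst k (weierstrassForm a b) = thetaCubic a b * (- X 1 ^ 3 * X 2 ^ 2) := by
        simp [thetaSubst, weierstrassForm, thetaCubic]
        ring
      simp only [SetLike.mem_coe, RingHom.mem_ker, thetaMap, AlgHom.comp_apply, this,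
        Ideal.Quotient.mkₐ_eq_mk]
      rw [Ideal.Quotient.eq_zero_iff_mem]
      exact Ideal.mul_mem_right _ _ (Ideal.mem_span_singleton_self _)
  exact this hx

theorem thetaMap_mem_deg {a b : k} {n : ℕ} {x : MvPolynomial (Fin 4) k} (hx : x.IsHomogeneous n) :
    thetaMap a b x ∈ ThetaRing.deg a b (4 * n) := by
  refine ThetaRing.mk_mem_deg (hx.aeval _ fun i => ?_)
  have h0 := isHomogeneous_X k (0 : Fin 3)
  have h1 := isHomogeneous_X k (1 : Fin 3)
  have h2 := isHomogeneous_X k (2 : Fin 3)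
  fin_cases i
  · exact h2.pow 4
  · exact (h1.mul h0).mul (h2.pow 2)
  · exact (h1.pow 3).mul h2
  · exact (h1.pow 2).mul (h0.pow 2)

/-- The monomials in `X₀, X₁, X₂, X₃` which are at most linear in `X₁` and `X₂`. -/
noncomputable def normalMonomial (k : Type*) [Field k] (i : ℕ × ℕ × Fin 2 × Fin 2) :
    MvPolynomial (Fin 4) k :=
  X 0 ^ i.1 * X 3 ^ i.2.1 * X 1 ^ (i.2.2.1 : ℕ) * X 2 ^ (i.2.2.2 : ℕ)

/-- The indices of the normal monomials of degree at most `M`. -/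
def normalIndices (M : ℕ) : Finset (ℕ × ℕ × Fin 2 × Fin 2) :=
  (Finset.range (M + 1) ×ˢ Finset.range (M + 1) ×ˢ Finset.univ ×ˢ Finset.univ).filter
    fun i => i.1 + i.2.1 + i.2.2.1 + i.2.2.2 ≤ M

theorem mem_normalIndices {M : ℕ} {i : ℕ × ℕ × Fin 2 × Fin 2} :
    i ∈ normalIndices M ↔ i.1 + i.2.1 + i.2.2.1 + i.2.2.2 ≤ M := by
  simp only [normalIndices, Finset.mem_filter, Finset.mem_product, Finset.mem_range,
    Finset.mem_univ, and_true]
  omega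

theorem card_filter_add_lt (m N : ℕ) (h : m ≤ N) :
    2 * ((Finset.range N ×ˢ Finset.range N).filter fun i => i.1 + i.2 < m).card = m * (m + 1) := by
  induction m with
  | zero => simp
  | succ m ih =>
    have e : ((Finset.range N ×ˢ Finset.range N).filter fun i => i.1 + i.2 < m + 1) =
        ((Finset.range N ×ˢ Finset.range N).filter fun i => i.1 + i.2 < m) ∪
          Finset.HasAntidiagonal.antidiagonal m := by
      ext ⟨i, j⟩
      simp
      omega
    rw [e, Finset.card_union_of_disjoint, Finset.Nat.card_antidiagonal, mul_add, ih (by omega)]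
    · ring
    · rw [Finset.disjoint_left]
      rintro ⟨i, j⟩
      simp
      omega

theorem card_normalIndices (M : ℕ) : (normalIndices M).card = 1 + 2 * M * (M + 1) := by
  have e : normalIndices M =
      (Finset.univ : Finset (Fin 2 × Fin 2)).biUnion fun c =>
        ((Finset.range (M + 1) ×ˢ Finset.range (M + 1)).filter
          fun i => i.1 + i.2 < M + 1 - c.1 - c.2).image fun i => (i.1, i.2, c.1, c.2) := by
    ext ⟨i, j, c, d⟩
    rw [mem_normalIndices]
    simp
    omega
  rw [e, Finset.card_biUnion]
  · have hinj : ∀ c : Fin 2 × Fin 2, Function.Injective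
        fun i : ℕ × ℕ => (i.1, i.2, c.1, c.2) := by
      rintro c ⟨i, j⟩ ⟨i', j'⟩ h
      simpa using h
    simp only [Finset.card_image_of_injective _ (hinj _)]
    simp only [Fintype.sum_prod_type, Fin.sum_univ_two, Fin.val_zero, Fin.val_one]
    have h1 := card_filter_add_lt (M + 1 - 0 - 0) (M + 1) (by omega)
    have h2 := card_filter_add_lt (M + 1 - 0 - 1) (M + 1) (by omega)
    have h2' := card_filter_add_lt (M + 1 - 1 - 0) (M + 1) (by omega)
    have h3 := card_filter_add_lt (M + 1 - 1 - 1) (M + 1) (by omega)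
    have h4 : (M + 1 - 1 - 1) * (M + 1 - 1 - 1 + 1) + 2 * M = M * (M + 1) := by
      cases M with
      | zero => rfl
      | succ M => simp; ring
    simp only [Nat.sub_zero, Nat.add_sub_cancel] at h1 h2 h2' h3 h4 ⊢
    nlinarith
  · rintro c - d - hcd
    rw [Function.onFun, Finset.disjoint_left]
    rintro x hx hy
    simp only [Finset.mem_image] at hx hy
    obtain ⟨i, -, rfl⟩ := hx
    obtain ⟨j, -, h⟩ := hy
    apply hcd
    simp only [Prod.mk.injEq] at h
    exact Prod.ext h.2.2.1.symm h.2.2.2.symm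

/-- The polynomials congruent to a combination of normal monomials of degree at most `M`. -/
noncomputable def normalSpan (a b : k) (M : ℕ) : Submodule k (MvPolynomial (Fin 4) k) :=
  Submodule.span k (normalMonomial k '' normalIndices M) ⊔
    (weierstrassIdeal a b).restrictScalars k

theorem normalMonomial_mem_normalSpan {a b : k} {M : ℕ} {i : ℕ × ℕ × Fin 2 × Fin 2}
    (hi : i.1 + i.2.1 + i.2.2.1 + i.2.2.2 ≤ M) : normalMonomial k i ∈ normalSpan a b M :=
  Submodule.mem_sup_left (Submodule.subset_span ⟨i, mem_normalIndices.2 hi, rfl⟩)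

theorem mem_normalSpan_of_mem_ideal {a b : k} {M : ℕ} {x : MvPolynomial (Fin 4) k}
    (hx : x ∈ weierstrassIdeal a b) : x ∈ normalSpan a b M :=
  Submodule.mem_sup_right hx

theorem mul_mem_normalSpan {a b : k} {M N : ℕ} {x y : MvPolynomial (Fin 4) k}
    (h : ∀ i ∈ normalIndices M, x * normalMonomial k i ∈ normalSpan a b N)
    (hy : y ∈ normalSpan a b M) : x * y ∈ normalSpan a b N := by
  have : normalSpan a b M ≤ (normalSpan a b N).comap (LinearMap.mulLeft k x) := by
    refine sup_le (Submodule.span_le.2 ?_) fun z hz => ?_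
    · rintro _ ⟨i, hi, rfl⟩
      exact h i hi
    · exact mem_normalSpan_of_mem_ideal (Ideal.mul_mem_left _ _ hz)
  exact this hy

theorem normalSpan_mono {a b : k} {M N : ℕ} (h : M ≤ N) : normalSpan a b M ≤ normalSpan a b N := by
  intro x hx
  rw [← one_mul x]
  refine mul_mem_normalSpan (fun i hi => ?_) hx
  rw [one_mul]
  exact normalMonomial_mem_normalSpan ((mem_normalIndices.1 hi).trans h)

theorem X_mul_mem_normalSpan {a b : k} {M : ℕ} {y : MvPolynomial (Fin 4) k}
    (hy : y ∈ normalSpan a b M) (r : Fin 4) : X r * y ∈ normalSpan a b (M + 1) := by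
  have hJ1 : ∀ x, conicForm k * x ∈ weierstrassIdeal a b := fun x =>
    Ideal.mul_mem_right _ _ (Ideal.subset_span (by simp))
  have hJ2 : ∀ x, weierstrassForm a b * x ∈ weierstrassIdeal a b := fun x =>
    Ideal.mul_mem_right _ _ (Ideal.subset_span (by simp))
  have h0 : ∀ M, ∀ i ∈ normalIndices M, X 0 * normalMonomial k i ∈ normalSpan a b (M + 1) := by
    rintro M ⟨i, j, c, d⟩ hi
    have hi := mem_normalIndices.1 hi
    have e : X 0 * normalMonomial k (i, j, c, d) = normalMonomial k (i + 1, j, c, d) := by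
      simp [normalMonomial]
      ring
    rw [e]
    exact normalMonomial_mem_normalSpan (by simp at hi ⊢; omega)
  have h3 : ∀ M, ∀ i ∈ normalIndices M, X 3 * normalMonomial k i ∈ normalSpan a b (M + 1) := by
    rintro M ⟨i, j, c, d⟩ hi
    have hi := mem_normalIndices.1 hi
    have e : X 3 * normalMonomial k (i, j, c, d) = normalMonomial k (i, j + 1, c, d) := by
      simp [normalMonomial]
      ring
    rw [e]
    exact normalMonomial_mem_normalSpan (by simp at hi ⊢; omega)
  have h1 : ∀ M, ∀ i ∈ normalIndices M, X 1 * normalMonomial k i ∈ normalSpan a b (M + 1) := by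
    rintro M ⟨i, j, c, d⟩ hi
    have hi := mem_normalIndices.1 hi
    match c with
    | 0 =>
      have e : X 1 * normalMonomial k (i, j, 0, d) = normalMonomial k (i, j, 1, d) := by
        simp [normalMonomial]
        ring
      rw [e]
      exact normalMonomial_mem_normalSpan (by simp at hi ⊢; omega)
    | 1 =>
      have e : X 1 * normalMonomial k (i, j, 1, d) = normalMonomial k (i + 1, j + 1, 0, d) -
          conicForm k * (X 0 ^ i * X 3 ^ j * X 2 ^ (d : ℕ)) := by
        simp [normalMonomial, conicForm]
        ring
      rw [e]
      exact sub_mem (normalMonomial_mem_normalSpan (by simp at hi ⊢; omega))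
        (mem_normalSpan_of_mem_ideal (hJ1 _))
  have h2 : ∀ M, ∀ i ∈ normalIndices M, X 2 * normalMonomial k i ∈ normalSpan a b (M + 1) := by
    rintro M ⟨i, j, c, d⟩ hi
    have hi' := mem_normalIndices.1 hi
    match d with
    | 0 =>
      have e : X 2 * normalMonomial k (i, j, c, 0) = normalMonomial k (i, j, c, 1) := by
        simp [normalMonomial]
        ring
      rw [e]
      exact normalMonomial_mem_normalSpan (by simp at hi' ⊢; omega)
    | 1 =>
      have e : X 2 * normalMonomial k (i, j, c, 1) =
          weierstrassForm a b * (X 0 ^ i * X 3 ^ j * X 1 ^ (c : ℕ)) -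
          (3 * a) • (X 1 * normalMonomial k (i, j, c, 1)) -
          b • (X 0 * normalMonomial k (i, j, c, 1)) + X 1 * normalMonomial k (i, j + 1, c, 0) := by
        simp [normalMonomial, weierstrassForm, smul_eq_C_mul]
        ring
      rw [e]
      refine add_mem (sub_mem (sub_mem (mem_normalSpan_of_mem_ideal (hJ2 _))
        (Submodule.smul_mem _ _ (h1 M _ hi))) (Submodule.smul_mem _ _ (h0 M _ hi)))
        (h1 M _ (mem_normalIndices.2 ?_))
      simp at hi' ⊢
      omega
  refine mul_mem_normalSpan (fun i hi => ?_) hy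
  fin_cases r
  · exact h0 M i hi
  · exact h1 M i hi
  · exact h2 M i hi
  · exact h3 M i hi

theorem mem_normalSpan_of_totalDegree_le (a b : k) {M : ℕ} {x : MvPolynomial (Fin 4) k}
    (hx : x.totalDegree ≤ M) : x ∈ normalSpan a b M := by
  have hmon : ∀ (N : ℕ) (m : Fin 4 →₀ ℕ), m.degree = N → monomial m (1 : k) ∈ normalSpan a b N := by
    intro N
    induction N with
    | zero =>
      intro m hm
      obtain rfl : m = 0 := by simpa [Finsupp.degree_eq_zero_iff] using hm
      have : monomial 0 (1 : k) = normalMonomial k (0, 0, 0, 0) := by simp [normalMonomial]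
      rw [this]
      exact normalMonomial_mem_normalSpan (by simp)
    | succ N ih =>
      intro m hm
      obtain ⟨r, hr⟩ : ∃ r, m r ≠ 0 := by
        by_contra! h
        obtain rfl : m = 0 := Finsupp.ext h
        simp at hm
      have e : m = Finsupp.single r 1 + (m - Finsupp.single r 1) := by
        ext s
        by_cases h : s = r
        · subst h; simp; omega
        · simp [Ne.symm h]
      have e2 : monomial m (1 : k) = X r * monomial (m - Finsupp.single r 1) 1 := by
        rw [X, monomial_mul, ← e, one_mul]
      rw [e2]
      refine X_mul_mem_normalSpan (ih _ ?_) r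
      have := congrArg Finsupp.degree e
      rw [map_add, Finsupp.degree_single, hm] at this
      omega
  rw [x.as_sum]
  refine sum_mem fun m hm => ?_
  have e : monomial m (coeff m x) = coeff m x • monomial m (1 : k) := by simp [smul_monomial]
  rw [e]
  refine Submodule.smul_mem _ _ (normalSpan_mono ?_ (hmon _ m rfl))
  exact (le_totalDegree hm).trans hx

theorem exists_sub_mem_of_totalDegree_le (a b : k) {M : ℕ} {x : MvPolynomial (Fin 4) k}
    (hx : x.totalDegree ≤ M) :
    ∃ y ∈ Submodule.span k (normalMonomial k '' normalIndices M), x - y ∈ weierstrassIdeal a b := by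
  obtain ⟨y, hy, z, hz, rfl⟩ := Submodule.mem_sup.1 (mem_normalSpan_of_totalDegree_le a b hx)
  exact ⟨y, hy, by simpa using hz⟩

/-- The exponents of the normal monomials in the coordinates `x, t` of the elliptic curve. -/
noncomputable def normalExponent (i : ℕ × ℕ × Fin 2 × Fin 2) : Fin 2 →₀ ℕ :=
  Finsupp.single 0 (2 * i.2.1 + i.2.2.1) + Finsupp.single 1 (4 * i.1 + 2 * i.2.2.1 + i.2.2.2)

theorem normalExponent_injective : Function.Injective normalExponent := by
  rintro ⟨i, j, c, d⟩ ⟨i', j', c', d'⟩ h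
  have h0 := DFunLike.congr_fun h 0
  have h1 := DFunLike.congr_fun h 1
  simp [normalExponent] at h0 h1
  simp only [Prod.mk.injEq, Fin.ext_iff]
  omega

theorem sum_normal_eq_zero [IsAlgClosed k] {a b : k} (hb : b ≠ 0)
    (s : Finset (ℕ × ℕ × Fin 2 × Fin 2)) (r : ℕ × ℕ × Fin 2 × Fin 2 → k)
    (h : thetaMap a b (∑ i ∈ s, r i • normalMonomial k i) = 0) : ∀ i ∈ s, r i = 0 := by
  let U : Fin 2 → MvPolynomial (Fin 2) k := fun d =>
    ∑ i ∈ s.filter (fun i => i.2.2.2 = d), monomial (normalExponent i) (r i)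
  suffices hU : ∀ d, U d = 0 by
    intro i hi
    have h1 := congrArg (coeff (normalExponent i)) (hU i.2.2.2)
    simp only [U, coeff_sum, coeff_monomial, coeff_zero, normalExponent_injective.eq_iff] at h1
    rwa [Finset.sum_ite_eq', if_pos (by simp [hi])] at h1
  let D : MvPolynomial (Fin 2) k :=
    (C (3 * a) * X 0 * X 1 + C b * X 1 ^ 3) ^ 2 + 4 * X 0 ^ 3
  have hD : D ≠ 0 := by
    intro h
    have := congrArg (eval ![0, 1]) h
    simp [D, hb] at this
  have hval : ∀ x t y : k, x ≠ 0 → y ^ 2 + (3 * a * x * t + b * t ^ 3) * y = x ^ 3 →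
      eval ![x, t] (U 0) + y * eval ![x, t] (U 1) = 0 := by
    intro x t y hx hxy
    have hy0 : y ≠ 0 := by
      rintro rfl
      simp at hxy
      exact hx (pow_eq_zero_iff three_ne_zero |>.1 hxy.symm)
    obtain ⟨w, hw⟩ := IsAlgClosed.exists_pow_nat_eq y (n := 3) (by norm_num)
    have hw0 : w ≠ 0 := by rintro rfl; simp at hw; exact hy0 hw.symm
    rw [thetaMap, AlgHom.comp_apply, Ideal.Quotient.mkₐ_eq_mk, Ideal.Quotient.eq_zero_iff_mem,
      Ideal.mem_span_singleton] at h
    obtain ⟨m, hm⟩ := h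
    have hc : eval ![x / w, w, t] (thetaCubic a b) = 0 := by
      simp [thetaCubic]
      field_simp
      subst hw
      linear_combination -hxy
    have h1 := congrArg (eval ![x / w, w, t]) hm
    rw [map_mul, hc, zero_mul, map_sum, map_sum] at h1
    have h2 : ∀ i, eval ![x / w, w, t] (thetaSubst k (r i • normalMonomial k i)) =
        y ^ (i.2.2.2 : ℕ) * eval ![x, t] (monomial (normalExponent i) (r i)) := by
      rintro ⟨i, j, c, d⟩
      obtain ⟨z, rfl⟩ : ∃ z, x = w * z := ⟨x / w, (mul_div_cancel₀ x hw0).symm⟩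
      rw [mul_div_cancel_left₀ z hw0]
      simp [thetaSubst, normalMonomial, normalExponent, eval_monomial, Finsupp.prod_add_index',
        pow_add, ← hw]
      ring
    simp only [h2] at h1
    rw [← h1, ← Finset.sum_fiberwise s (fun i => i.2.2.2), Fin.sum_univ_two]
    simp only [U, map_sum, Finset.mul_sum]
    congr 1
    · refine Finset.sum_congr rfl fun i hi => ?_
      simp [(Finset.mem_filter.1 hi).2]
    · refine Finset.sum_congr rfl fun i hi => ?_
      simp [(Finset.mem_filter.1 hi).2]
  have key : ∀ d, X 0 * D * U d = 0 := by
    intro d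
    refine MvPolynomial.funext fun v => ?_
    obtain ⟨x, t, rfl⟩ : ∃ x t, v = ![x, t] := ⟨v 0, v 1, by ext i; fin_cases i <;> rfl⟩
    by_cases hx : x = 0
    · simp [hx]
    by_cases hDv : eval ![x, t] D = 0
    · simp [hDv]
    obtain ⟨y, hy⟩ := IsAlgClosed.exists_root
      (Polynomial.X ^ 2 + Polynomial.C (3 * a * x * t + b * t ^ 3) * Polynomial.X -
        Polynomial.C (x ^ 3) : Polynomial k) (by
          have : (Polynomial.X ^ 2 + Polynomial.C (3 * a * x * t + b * t ^ 3) * Polynomial.X -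
            Polynomial.C (x ^ 3) : Polynomial k).degree = 2 := by compute_degree!
          rw [this]; norm_num)
    simp only [Polynomial.IsRoot, Polynomial.eval_sub, Polynomial.eval_add, Polynomial.eval_mul,
      Polynomial.eval_pow, Polynomial.eval_X, Polynomial.eval_C] at hy
    have h1 := hval x t y hx (by linear_combination hy)
    have h2 := hval x t (-(3 * a * x * t + b * t ^ 3) - y) hx (by linear_combination hy)
    have hne : 2 * y + (3 * a * x * t + b * t ^ 3) ≠ 0 := by
      intro h
      apply hDv
      simp [D]
      linear_combination (2 * y + (3 * a * x * t + b * t ^ 3)) * h - 4 * hy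
    have hV : eval ![x, t] (U 1) = 0 :=
      (mul_eq_zero.1 (show (2 * y + (3 * a * x * t + b * t ^ 3)) * eval ![x, t] (U 1) = 0 by
        linear_combination h1 - h2)).resolve_left hne
    have hU : eval ![x, t] (U 0) = 0 := by rw [hV] at h1; simpa using h1
    fin_cases d
    · simp [hU]
    · simp [hV]
  intro d
  exact (mul_eq_zero.1 (key d)).resolve_left (mul_ne_zero (X_ne_zero 0) hD)

variable {a b : k}

theorem linearIndependent_thetaMap_normalMonomial [IsAlgClosed k] (hb : b ≠ 0) :
    LinearIndependent k fun i => thetaMap a b (normalMonomial k i) := by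
  rw [linearIndependent_iff']
  intro s r h
  exact sum_normal_eq_zero hb s r (by simpa using h)

theorem mem_weierstrassIdeal_iff [IsAlgClosed k] (hb : b ≠ 0)
    {x : MvPolynomial (Fin 4) k} :
    x ∈ weierstrassIdeal a b ↔ thetaMap a b x = 0 := by
  refine ⟨thetaMap_eq_zero_of_mem, fun h => ?_⟩
  obtain ⟨y, hy, hxy⟩ := exists_sub_mem_of_totalDegree_le a b (le_refl x.totalDegree)
  have h1 := thetaMap_eq_zero_of_mem hxy
  rw [map_sub, h, zero_sub, neg_eq_zero] at h1
  obtain ⟨r, hsr⟩ := (Submodule.mem_span_image_finset_iff_exists_fun' k).1 hy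
  rw [← hsr] at h1
  have h2 := sum_normal_eq_zero hb _ r h1
  have : y = 0 := by
    rw [← hsr]
    exact Finset.sum_eq_zero fun i hi => by rw [h2 i hi, zero_smul]
  simpa [this] using hxy

/-- The image of the polynomials of degree at most `M` in the coordinate ring. -/
noncomputable def coordinateRingLE (a b : k) (M : ℕ) :
    Submodule k (MvPolynomial (Fin 4) k ⧸ weierstrassIdeal a b) :=
  (restrictTotalDegree (Fin 4) k M).map (Ideal.Quotient.mkₐ k (weierstrassIdeal a b)).toLinearMap

theorem mk_mem_coordinateRingLE {M : ℕ} {x : MvPolynomial (Fin 4) k}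
    (hx : x.totalDegree ≤ M) :
    Ideal.Quotient.mk (weierstrassIdeal a b) x ∈ coordinateRingLE a b M :=
  ⟨x, (mem_restrictTotalDegree _ _ _).2 hx, rfl⟩

theorem totalDegree_normalMonomial_le (i : ℕ × ℕ × Fin 2 × Fin 2) :
    (normalMonomial k i).totalDegree ≤ i.1 + i.2.1 + i.2.2.1 + i.2.2.2 := by
  have h (j : Fin 4) (n : ℕ) : (X j ^ n : MvPolynomial (Fin 4) k).totalDegree ≤ n :=
    (totalDegree_X_pow j n).le
  exact (totalDegree_mul _ _).trans (add_le_add ((totalDegree_mul _ _).trans (add_le_add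
    ((totalDegree_mul _ _).trans (add_le_add (h _ _) (h _ _))) (h _ _))) (h _ _))

theorem coordinateRingLE_eq_span (a b : k) (M : ℕ) : coordinateRingLE a b M =
    Submodule.span k (Set.range fun i : normalIndices M =>
      Ideal.Quotient.mk (weierstrassIdeal a b) (normalMonomial k i)) := by
  refine le_antisymm ?_ (Submodule.span_le.2 ?_)
  · rintro _ ⟨x, hx, rfl⟩
    obtain ⟨y, hy, hxy⟩ :=
      exists_sub_mem_of_totalDegree_le a b ((mem_restrictTotalDegree _ _ _).1 hx)
    have e : (Ideal.Quotient.mkₐ k (weierstrassIdeal a b)).toLinearMap x =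
        (Ideal.Quotient.mkₐ k (weierstrassIdeal a b)).toLinearMap y := Ideal.Quotient.eq.2 hxy
    rw [e]
    have h := Submodule.mem_map_of_mem
      (f := (Ideal.Quotient.mkₐ k (weierstrassIdeal a b)).toLinearMap) hy
    rw [Submodule.map_span, ← Set.image_comp] at h
    refine Submodule.span_mono ?_ h
    rintro _ ⟨i, hi, rfl⟩
    exact ⟨⟨i, hi⟩, rfl⟩
  · rintro _ ⟨i, rfl⟩
    exact mk_mem_coordinateRingLE ((totalDegree_normalMonomial_le _).trans
      (mem_normalIndices.1 i.2))

theorem finrank_coordinateRingLE [IsAlgClosed k] (hb : b ≠ 0) (M : ℕ) :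
    Module.finrank k (coordinateRingLE a b M) = 1 + 2 * M * (M + 1) := by
  rw [coordinateRingLE_eq_span, finrank_span_eq_card, Fintype.card_coe, card_normalIndices]
  let φ := Ideal.Quotient.liftₐ (weierstrassIdeal a b) (thetaMap a b)
    fun x hx => thetaMap_eq_zero_of_mem hx
  refine LinearIndependent.of_comp φ.toLinearMap ?_
  exact (linearIndependent_thetaMap_normalMonomial hb).comp _ Subtype.val_injective

end NormalForm

section Syzygies

variable {k : Type*} [Field k] {a b : k}

theorem thetaMap_X (a b : k) (i : Fin 4) : thetaMap a b (X i) =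
    Ideal.Quotient.mk _ (![X 2 ^ 4, X 1 * X 0 * X 2 ^ 2, X 1 ^ 3 * X 2, X 1 ^ 2 * X 0 ^ 2] i) := by
  simp [thetaMap, thetaSubst]

theorem thetaMap_sum (a b : k) (q : ℕ) (y : Fin 4 → MvPolynomial (Fin 4) k) :
    thetaMap a b (∑ i, y i * X i ^ q) =
      thetaMap a b (y 0) * (Ideal.Quotient.mk _ (X 2) ^ q) ^ 4 +
      thetaMap a b (y 1) * (Ideal.Quotient.mk _ (X 1) ^ q * Ideal.Quotient.mk _ (X 0) ^ q *
        (Ideal.Quotient.mk _ (X 2) ^ q) ^ 2) +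
      thetaMap a b (y 2) * ((Ideal.Quotient.mk _ (X 1) ^ q) ^ 3 * Ideal.Quotient.mk _ (X 2) ^ q) +
      thetaMap a b (y 3) *
        ((Ideal.Quotient.mk _ (X 1) ^ q) ^ 2 * (Ideal.Quotient.mk _ (X 0) ^ q) ^ 2) := by
  simp only [Fin.sum_univ_four, map_add, map_mul, map_pow, thetaMap_X, Matrix.cons_val]
  ring

variable [IsAlgClosed k]

theorem ThetaRing.exists_isCubicCone (h3 : (3 : k) ≠ 0) (hb : b ≠ 0) (hab : b - a ^ 3 ≠ 0) :
    ∃ ω, IsCubicCone (ThetaRing.deg a b) (algebraMap k (ThetaRing a b) a) (algebraMap k _ b) ω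
      (Ideal.Quotient.mk _ (X 1)) (Ideal.Quotient.mk _ (X 0)) (Ideal.Quotient.mk _ (X 2)) := by
  obtain ⟨ω, hω⟩ := IsAlgClosed.exists_root
      (Polynomial.X ^ 2 + Polynomial.X + 1 : Polynomial k) (by
          have : (Polynomial.X ^ 2 + Polynomial.X + 1 : Polynomial k).degree = 2 := by
            compute_degree!
          rw [this]; norm_num)
  exact ⟨_, ThetaRing.isCubicCone h3 hab hb (ω := ω) (by simpa using hω)⟩

variable (p e : ℕ) [Fact p.Prime] [CharP k p]

theorem mem_weierstrassIdeal_of_syzygy (h3 : (3 : k) ≠ 0) (hb : b ≠ 0) (hab : b - a ^ 3 ≠ 0)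
    {d : ℕ} (hd : 3 * d < p ^ e) {y : Fin 4 → MvPolynomial (Fin 4) k}
    (hy : ∀ i, (y i).IsHomogeneous d)
    (hrel : ∑ i, y i * X i ^ p ^ e ∈ weierstrassIdeal a b) (i : Fin 4) :
    y i ∈ weierstrassIdeal a b := by
  have := ThetaRing.isDomain (a := a) (b := b) h3 hab
  have : CharP (ThetaRing a b) p :=
    charP_of_injective_algebraMap (algebraMap k (ThetaRing a b)).injective p
  obtain ⟨ω, h⟩ := ThetaRing.exists_isCubicCone h3 hb hab
  rw [mem_weierstrassIdeal_iff hb] at hrel ⊢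
  rw [thetaMap_sum] at hrel
  exact IsCubicCone.syzygy_eq_zero p e h (n := 4 * d) (α := fun i => thetaMap a b (y i))
    (by omega) (fun i => thetaMap_mem_deg (hy i)) hrel i

theorem mem_weierstrassIdeal_of_alternating_syzygy (h3 : (3 : k) ≠ 0) (hb : b ≠ 0)
    (hab : b - a ^ 3 ≠ 0)
    {d : ℕ} (hd : 3 * d < 2 * p ^ e) {y : Fin 4 → Fin 4 → MvPolynomial (Fin 4) k}
    (hy : ∀ i j, (y i j).IsHomogeneous d) (hdiag : ∀ i, y i i = 0)
    (hanti : ∀ i j, y i j = -y j i)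
    (hrel : ∀ i, ∑ j, y i j * X j ^ p ^ e ∈ weierstrassIdeal a b) (i j : Fin 4) :
    y i j ∈ weierstrassIdeal a b := by
  have := ThetaRing.isDomain (a := a) (b := b) h3 hab
  have : CharP (ThetaRing a b) p :=
    charP_of_injective_algebraMap (algebraMap k (ThetaRing a b)).injective p
  obtain ⟨ω, h⟩ := ThetaRing.exists_isCubicCone h3 hb hab
  rw [mem_weierstrassIdeal_iff hb]
  refine IsCubicCone.alternating_syzygy_eq_zero p e h (n := 4 * d)
    (β := fun i j => thetaMap a b (y i j)) (by omega) (fun i j => thetaMap_mem_deg (hy i j))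
    (fun i => by simp [hdiag]) (fun i j => by simp [hanti i j]) (fun i => ?_) i j
  have := hrel i
  rwa [mem_weierstrassIdeal_iff hb, thetaMap_sum] at this

end Syzygies

section Duality

variable {σ k : Type*} [Field k]

/-- The ideal generated by the `q`-th powers of the variables in `s`. -/
noncomputable def powIdeal (k : Type*) [Field k] (q : ℕ) (s : Set σ) : Ideal (MvPolynomial σ k) :=
  Ideal.span ((fun i => X i ^ q) '' s)

theorem mem_powIdeal {q : ℕ} {s : Set σ} {x : MvPolynomial σ k} :
    x ∈ powIdeal k q s ↔ ∀ m ∈ x.support, ∃ i ∈ s, q ≤ m i := by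
  have e : (fun i => X i ^ q : σ → MvPolynomial σ k) '' s =
      (fun m => monomial m 1) '' ((fun i => Finsupp.single i q) '' s) := by
    rw [Set.image_image]
    simp [X_pow_eq_monomial]
  rw [powIdeal, e, mem_ideal_span_monomial_image]
  simp

theorem mem_powIdeal_of_mul_mem {q : ℕ} {s : Set σ} {x : MvPolynomial σ k} {i : σ} (hi : i ∉ s)
    (h : x * X i ^ q ∈ powIdeal k q s) : x ∈ powIdeal k q s := by
  classical
  rw [mem_powIdeal] at h ⊢
  intro m hm
  obtain ⟨j, hj, hq⟩ := h (m + Finsupp.single i q) (by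
    rw [mem_support_iff, X_pow_eq_monomial, coeff_mul_monomial]
    simpa using hm)
  refine ⟨j, hj, ?_⟩
  have hij : i ≠ j := fun h => hi (h ▸ hj)
  simpa [hij] using hq

theorem X_pow_mem_powIdeal {q : ℕ} {s : Set σ} {i : σ} (hi : i ∈ s) :
    X i ^ q ∈ powIdeal k q s := Ideal.subset_span ⟨i, hi, rfl⟩

theorem exists_koszul {q : ℕ} {y : Fin 4 → MvPolynomial (Fin 4) k}
    (h : ∑ i, y i * X i ^ q = 0) : ∃ c : Fin 4 → Fin 4 → MvPolynomial (Fin 4) k,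
      (∀ i, c i i = 0) ∧ (∀ i j, c i j = -c j i) ∧ ∀ i, y i = ∑ j, c i j * X j ^ q := by
  rw [Fin.sum_univ_four] at h
  have h3 : y 3 ∈ powIdeal k q ({0, 1, 2} : Set (Fin 4)) := by
    refine mem_powIdeal_of_mul_mem (i := 3) (by decide) ?_
    have : y 3 * X 3 ^ q = -(y 0 * X 0 ^ q + y 1 * X 1 ^ q + y 2 * X 2 ^ q) := by
      linear_combination h
    rw [this]
    exact neg_mem (add_mem (add_mem (Ideal.mul_mem_left _ _ (X_pow_mem_powIdeal (by simp)))
      (Ideal.mul_mem_left _ _ (X_pow_mem_powIdeal (by simp))))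
      (Ideal.mul_mem_left _ _ (X_pow_mem_powIdeal (by simp))))
  rw [powIdeal, Set.image_insert_eq, Set.image_pair] at h3
  obtain ⟨r0, z, hz, h3⟩ := Ideal.mem_span_insert.1 h3
  obtain ⟨r1, r2, rfl⟩ := Ideal.mem_span_pair.1 hz
  have h2 : y 2 + r2 * X 3 ^ q ∈ powIdeal k q ({0, 1} : Set (Fin 4)) := by
    refine mem_powIdeal_of_mul_mem (i := 2) (by decide) ?_
    have : (y 2 + r2 * X 3 ^ q) * X 2 ^ q =
        -((y 0 + r0 * X 3 ^ q) * X 0 ^ q + (y 1 + r1 * X 3 ^ q) * X 1 ^ q) := by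
      linear_combination h - X 3 ^ q * h3
    rw [this]
    exact neg_mem (add_mem (Ideal.mul_mem_left _ _ (X_pow_mem_powIdeal (by simp)))
      (Ideal.mul_mem_left _ _ (X_pow_mem_powIdeal (by simp))))
  rw [powIdeal, Set.image_pair] at h2
  obtain ⟨s0, s1, h2⟩ := Ideal.mem_span_pair.1 h2
  have h1 : y 1 + r1 * X 3 ^ q + s1 * X 2 ^ q ∈ powIdeal k q ({0} : Set (Fin 4)) := by
    refine mem_powIdeal_of_mul_mem (i := 1) (by decide) ?_
    have : (y 1 + r1 * X 3 ^ q + s1 * X 2 ^ q) * X 1 ^ q =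
        -(y 0 + r0 * X 3 ^ q + s0 * X 2 ^ q) * X 0 ^ q := by
      linear_combination h - X 3 ^ q * h3 + X 2 ^ q * h2
    rw [this]
    exact Ideal.mul_mem_left _ _ (X_pow_mem_powIdeal (by simp))
  rw [powIdeal, Set.image_singleton] at h1
  obtain ⟨t, h1⟩ := Ideal.mem_span_singleton'.1 h1
  have h0 : y 0 + r0 * X 3 ^ q + s0 * X 2 ^ q + t * X 1 ^ q = 0 := by
    refine (mul_eq_zero_iff_right (pow_ne_zero q (X_ne_zero (R := k) (0 : Fin 4)))).1 ?_
    linear_combination h - X 3 ^ q * h3 + X 2 ^ q * h2 + X 1 ^ q * h1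
  refine ⟨!![0, -t, -s0, -r0; t, 0, -s1, -r1; s0, s1, 0, -r2; r0, r1, r2, 0], ?_, ?_, ?_⟩
  · intro i; fin_cases i <;> rfl
  · intro i j; fin_cases i <;> fin_cases j <;> simp
  · intro i
    fin_cases i <;> simp [Fin.sum_univ_four]
    · linear_combination h0
    · linear_combination -h1
    · linear_combination -h2
    · linear_combination h3

theorem exists_koszul_isHomogeneous {q d : ℕ} {y : Fin 4 → MvPolynomial (Fin 4) k}
    (hy : ∀ i, (y i).IsHomogeneous d)
    (h : ∑ i, y i * X i ^ q = 0) : ∃ c : Fin 4 → Fin 4 → MvPolynomial (Fin 4) k,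
      (∀ i j, (c i j).IsHomogeneous (d - q)) ∧
      (∀ i, c i i = 0) ∧ (∀ i j, c i j = -c j i) ∧ ∀ i, y i = ∑ j, c i j * X j ^ q := by
  obtain ⟨c, hc0, hc1, hc⟩ := exists_koszul h
  refine ⟨fun i j => if q ≤ d then homogeneousComponent (d - q) (c i j) else 0, ?_, ?_, ?_, ?_⟩
  · intro i j
    dsimp only
    split_ifs
    · exact homogeneousComponent_isHomogeneous _ _
    · exact isHomogeneous_zero _ _ _
  · simp [hc0]
  · intro i j
    dsimp only
    rw [hc1 i j]
    split_ifs <;> simp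
  · intro i
    have h1 := congrArg (homogeneousComponent d) (hc i)
    rw [homogeneousComponent_of_mem (hy i), if_pos rfl, map_sum] at h1
    rw [h1]
    refine Finset.sum_congr rfl fun j _ => ?_
    have hX : (X j ^ q : MvPolynomial (Fin 4) k).IsHomogeneous q := isHomogeneous_X_pow j q
    rw [mul_comm, homogeneousComponent_mul_of_isHomogeneous hX]
    split_ifs <;> ring

/-- The Macaulay inverse system of a linear functional. -/
noncomputable def dualForm [Fintype σ] [DecidableEq σ] (c : σ →₀ ℕ)
    (l : MvPolynomial σ k →ₗ[k] k) : MvPolynomial σ k :=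
  ∑ m ∈ Finset.Iic c, monomial (c - m) (l (monomial m 1))

theorem coeff_dualForm [Fintype σ] [DecidableEq σ] {c : σ →₀ ℕ} {l : MvPolynomial σ k →ₗ[k] k}
    (m : σ →₀ ℕ) :
    coeff m (dualForm c l) = if m ≤ c then l (monomial (c - m) 1) else 0 := by
  rw [dualForm, coeff_sum]
  simp only [coeff_monomial]
  split_ifs with h
  · rw [Finset.sum_eq_single (c - m)]
    · rw [if_pos (tsub_tsub_cancel_of_le h)]
    · intro m' hm' hne
      rw [if_neg]
      rintro rfl
      exact hne (tsub_tsub_cancel_of_le (Finset.mem_Iic.1 hm')).symm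
    · intro h'
      exact absurd (Finset.mem_Iic.2 tsub_le_self) h'
  · refine Finset.sum_eq_zero fun m' _ => if_neg ?_
    rintro rfl
    exact h tsub_le_self

theorem coeff_mul_dualForm [Fintype σ] [DecidableEq σ] {c : σ →₀ ℕ}
    {l : MvPolynomial σ k →ₗ[k] k} (hl : ∀ m, ¬ m ≤ c → l (monomial m 1) = 0)
    (f : MvPolynomial σ k) {m : σ →₀ ℕ} (hm : m ≤ c) :
    coeff m (f * dualForm c l) = l (f * monomial (c - m) 1) := by
  induction f using MvPolynomial.induction_on' with
  | monomial s r =>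
    rw [coeff_monomial_mul', coeff_dualForm, monomial_mul, mul_one]
    have e : monomial (s + (c - m)) r = r • monomial (s + (c - m)) (1 : k) := by
      simp [smul_monomial]
    rw [e, map_smul, smul_eq_mul]
    split_ifs with h1 h2
    · have : s + (c - m) = c - (m - s) := by
        ext i
        have := h1 i
        have := hm i
        simp
        omega
      rw [this]
    · exact absurd (tsub_le_self.trans hm) h2
    · rw [hl, mul_zero]
      intro h
      apply h1
      intro i
      have h1 := h i
      have h2 := hm i
      simp at h1
      omega
  | add f g hf hg => rw [add_mul, add_mul, coeff_add, map_add, hf, hg]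

theorem isHomogeneous_dualForm [Fintype σ] [DecidableEq σ] {c : σ →₀ ℕ}
    {l : MvPolynomial σ k →ₗ[k] k} {d : ℕ}
    (hl : ∀ m, m.degree ≠ d → l (monomial m 1) = 0) :
    (dualForm c l).IsHomogeneous (c.degree - d) := by
  intro m hm
  rw [coeff_dualForm] at hm
  split_ifs at hm with h
  · have h1 : (c - m).degree = d := by
      by_contra h1
      exact hm (hl _ h1)
    have h2 : c.degree = m.degree + (c - m).degree := by
      rw [← map_add, add_tsub_cancel_of_le h]
    rw [show (Finsupp.weight (1 : σ → ℕ)) m = m.degree from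
      (DFunLike.congr_fun Finsupp.degree_eq_weight_one m).symm]
    omega
  · exact absurd rfl hm

end Duality

section FrobeniusQuotient

variable {k : Type*} [Field k]

theorem conicForm_prime : Prime (conicForm k) := by
  have h0 : (X 3 : MvPolynomial (Fin 4) k).vars = {3} := vars_X
  have h1 : (-X 1 ^ 2 : MvPolynomial (Fin 4) k).vars ⊆ {1} := by
    rw [vars_neg]
    exact (vars_pow _ _).trans vars_X.subset
  have := irreducible_mul_X_add (X 3) (-X 1 ^ 2 : MvPolynomial (Fin 4) k) 0 (X_ne_zero 3)
    (by rw [h0]; decide) (fun h => absurd (h1 h) (by decide))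
    (isRelPrime_X_of_eval_ne_zero ![0, 1, 0, 0] rfl (by simp))
  have e : conicForm k = X 3 * X 0 + -X 1 ^ 2 := by rw [conicForm]; ring
  rw [e]
  exact this.prime

theorem conicForm_not_dvd_weierstrassForm (a b : k) : ¬ conicForm k ∣ weierstrassForm a b := by
  rintro ⟨y, hy⟩
  have := congrArg (eval ![0, 0, 1, 0]) hy
  simp [conicForm, weierstrassForm] at this

/-- The Frobenius power of the irrelevant ideal on the cone over the elliptic curve. -/
noncomputable def frobeniusIdeal (a b : k) (q : ℕ) : Ideal (MvPolynomial (Fin 4) k) :=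
  weierstrassIdeal a b ⊔ powIdeal k q Set.univ

theorem frobeniusIdeal_homogeneousComponent {a b : k} {q : ℕ} {x : MvPolynomial (Fin 4) k}
    (hx : x ∈ frobeniusIdeal a b q) (n : ℕ) :
    homogeneousComponent n x ∈ frobeniusIdeal a b q := by
  rw [frobeniusIdeal, weierstrassIdeal, powIdeal, ← Ideal.span_union] at hx ⊢
  refine Ideal.isHomogeneous_span_of_mvPolynomial ?_ hx n
  rintro y (hy | ⟨i, -, rfl⟩)
  · exact isHomogeneous_of_mem_weierstrassIdeal_gens a b y hy
  · exact ⟨q, isHomogeneous_X_pow i q⟩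

theorem mem_powIdeal_univ_iff {q : ℕ} {x : MvPolynomial (Fin 4) k} {n : ℕ}
    (hx : x.IsHomogeneous n) : x ∈ powIdeal k q Set.univ ↔
      ∃ y : Fin 4 → MvPolynomial (Fin 4) k, (∀ i, (y i).IsHomogeneous (n - q)) ∧
        x = ∑ i, y i * X i ^ q := by
  rw [powIdeal, Set.image_univ]
  constructor
  · intro h
    obtain ⟨y, hy⟩ := Ideal.mem_span_range_iff_exists_fun.1 h
    obtain ⟨y', h1, -, h2⟩ := hx.exists_coeffs (s := ∅) (by simp)
      (fun i : Fin 4 => isHomogeneous_X_pow (R := k) i q) (y := y) (by simp [← hy, mul_comm])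
    refine ⟨y', h1, ?_⟩
    simpa [sub_eq_zero, mul_comm] using h2
  · rintro ⟨y, -, rfl⟩
    exact Ideal.mem_span_range_iff_exists_fun.2 ⟨y, rfl⟩

theorem sum_alternating_eq_zero {A : Type*} [CommRing A] {β : Fin 4 → Fin 4 → A}
    (h0 : ∀ i, β i i = 0) (h1 : ∀ i j, β i j = -β j i) (x : Fin 4 → A) :
    ∑ i, (∑ j, β i j * x j) * x i = 0 := by
  simp only [Fin.sum_univ_four, h0]
  rw [h1 1 0, h1 2 0, h1 2 1, h1 3 0, h1 3 1, h1 3 2]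
  ring

theorem exists_alternating_of_mem_span_pair {A : Type*} [CommRing A] {f g : A}
    {c : Fin 4 → Fin 4 → A} (h0 : ∀ i, c i i = 0) (h1 : ∀ i j, c i j = -c j i)
    (h : ∀ i j, c i j ∈ Ideal.span {f, g}) : ∃ β γ : Fin 4 → Fin 4 → A,
      (∀ i, β i i = 0) ∧ (∀ i j, β i j = -β j i) ∧ (∀ i, γ i i = 0) ∧ (∀ i j, γ i j = -γ j i) ∧
      ∀ i j, c i j = g * β i j - f * γ i j := by
  choose γ β hβ using fun i j => Ideal.mem_span_pair.1 (h i j)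
  refine ⟨fun i j => if i < j then β i j else if j < i then -β j i else 0,
    fun i j => if i < j then -γ i j else if j < i then γ j i else 0, ?_, ?_, ?_, ?_, ?_⟩
  · simp
  · intro i j
    rcases lt_trichotomy i j with hij | rfl | hij
    · simp [hij, hij.not_gt]
    · simp
    · simp [hij, hij.not_gt]
  · simp
  · intro i j
    rcases lt_trichotomy i j with hij | rfl | hij
    · simp [hij, hij.not_gt]
    · simp
    · simp [hij, hij.not_gt]
  · intro i j
    rcases lt_trichotomy i j with hij | rfl | hij
    · simp only [hij, if_true, ← hβ i j]
      ring
    · simp [h0]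
    · simp only [hij, hij.not_gt, if_true, if_false, h1 i j, ← hβ j i]
      ring

variable [IsAlgClosed k] (p e : ℕ) [Fact p.Prime] [CharP k p] {a b : k}

/-- A form annihilated by the curve modulo the Frobenius power of the irrelevant ideal of
the polynomial ring lies in that Frobenius power, if its degree is small. -/
theorem mem_powIdeal_of_mul_mem_powIdeal (h3 : (3 : k) ≠ 0) (hb : b ≠ 0) (hab : b - a ^ 3 ≠ 0)
    {n : ℕ} (hn : 3 * (n + 4 - 2 * p ^ e) < 2 * p ^ e) {x : MvPolynomial (Fin 4) k}
    (hq : 1 < p ^ e)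
    (hx : x.IsHomogeneous n) (hf : conicForm k * x ∈ powIdeal k (p ^ e) Set.univ)
    (hg : weierstrassForm a b * x ∈ powIdeal k (p ^ e) Set.univ) :
    x ∈ powIdeal k (p ^ e) Set.univ := by
  set q := p ^ e with hqdef
  obtain ⟨u, hu, hfu⟩ := (mem_powIdeal_univ_iff (conicForm_isHomogeneous.mul hx)).1 hf
  obtain ⟨v, hv, hgv⟩ := (mem_powIdeal_univ_iff ((weierstrassForm_isHomogeneous a b).mul hx)).1 hg
  obtain ⟨c, hc, hc0, hc1, hcy⟩ := exists_koszul_isHomogeneous (q := q)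
    (y := fun i => weierstrassForm a b * u i - conicForm k * v i)
    (fun i => ((weierstrassForm_isHomogeneous a b).mul (hu i)).sub
      (conicForm_isHomogeneous.mul (hv i))) (by
        simp only [sub_mul, Finset.sum_sub_distrib, mul_assoc, ← Finset.mul_sum, ← hfu, ← hgv]
        ring)
  have hcJ := mem_weierstrassIdeal_of_alternating_syzygy p e h3 hb hab (by omega) hc hc0 hc1
    (fun i => by
      rw [← hqdef, ← hcy i]
      exact sub_mem (Ideal.mul_mem_right _ _ (Ideal.subset_span (by simp)))
        (Ideal.mul_mem_right _ _ (Ideal.subset_span (by simp))))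
  obtain ⟨β, γ, hβ0, hβ1, hγ0, hγ1, hβγ⟩ := exists_alternating_of_mem_span_pair hc0 hc1 hcJ
  have hdvd : ∀ i, conicForm k ∣ u i - ∑ j, β i j * X j ^ q := by
    intro i
    refine (conicForm_prime.dvd_or_dvd ?_).resolve_left (conicForm_not_dvd_weierstrassForm a b)
    refine ⟨v i - ∑ j, γ i j * X j ^ q, ?_⟩
    have := hcy i
    simp only [hβγ, sub_mul, Finset.sum_sub_distrib, mul_assoc, ← Finset.mul_sum] at this
    linear_combination this
  choose r hr using hdvd
  have hxr : x = ∑ i, r i * X i ^ q := by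
    refine mul_left_cancel₀ conicForm_prime.ne_zero ?_
    rw [hfu, Finset.mul_sum, ← sub_eq_zero, ← Finset.sum_sub_distrib]
    rw [← sum_alternating_eq_zero hβ0 hβ1 (fun i => X i ^ q)]
    refine Finset.sum_congr rfl fun i _ => ?_
    linear_combination X i ^ q * hr i
  rw [hxr]
  exact sum_mem fun i _ => Ideal.mul_mem_left _ _ (X_pow_mem_powIdeal (Set.mem_univ i))

/-- The Frobenius power of the irrelevant ideal contains all forms of degree more than
`4q / 3`. -/
theorem mem_frobeniusIdeal_of_isHomogeneous (h3 : (3 : k) ≠ 0) (hb : b ≠ 0)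
    (hab : b - a ^ 3 ≠ 0) {m : ℕ} (hm : 4 * p ^ e < 3 * m) {x : MvPolynomial (Fin 4) k}
    (hx : x.IsHomogeneous m) : x ∈ frobeniusIdeal a b (p ^ e) := by
  have hq : 0 < p ^ e := Nat.pow_pos (Fact.out : p.Prime).pos
  have hpow : powIdeal k (p ^ e) Set.univ ≤ frobeniusIdeal a b (p ^ e) := le_sup_right
  have hmon : ∀ μ : Fin 4 →₀ ℕ, μ.degree = m → monomial μ 1 ∈ frobeniusIdeal a b (p ^ e) := by
    intro μ hμ
    by_contra hK
    let c : Fin 4 →₀ ℕ := Finsupp.equivFunOnFinite.symm fun _ => p ^ e - 1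
    have hc : c.degree = 4 * (p ^ e - 1) := by
      simp [c, Finsupp.degree_eq_sum]
    have hnotle : ∀ ν : Fin 4 →₀ ℕ, ¬ ν ≤ c → monomial ν 1 ∈ powIdeal k (p ^ e) Set.univ := by
      intro ν hν
      rw [mem_powIdeal]
      intro τ hτ
      obtain rfl : τ = ν := by simpa using support_monomial_subset hτ
      by_contra! h
      refine hν fun i => ?_
      have := h i (Set.mem_univ i)
      simp [c]
      omega
    have hμc : μ ≤ c := by
      by_contra h
      exact hK (hpow (hnotle μ h))
    obtain ⟨l, hl, hlK⟩ := Submodule.exists_le_ker_of_notMem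
      (p := (frobeniusIdeal a b (p ^ e)).restrictScalars k) hK
    let l' := l ∘ₗ homogeneousComponent m
    have hl'K : ∀ y ∈ frobeniusIdeal a b (p ^ e), l' y = 0 := fun y hy =>
      hlK (frobeniusIdeal_homogeneousComponent hy m)
    have hl'μ : l' (monomial μ 1) ≠ 0 := by
      simp only [l', LinearMap.comp_apply]
      rwa [homogeneousComponent_of_mem (n := m) ((isHomogeneous_monomial 1 hμ)), if_pos rfl]
    have hl'd : ∀ ν : Fin 4 →₀ ℕ, ν.degree ≠ m → l' (monomial ν 1) = 0 := by
      intro ν hν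
      simp only [l', LinearMap.comp_apply]
      rw [homogeneousComponent_of_mem (n := ν.degree) (isHomogeneous_monomial 1 rfl),
        if_neg hν.symm,
        map_zero]
    have hl'c : ∀ ν, ¬ ν ≤ c → l' (monomial ν 1) = 0 := fun ν hν => hl'K _ (hpow (hnotle ν hν))
    have hmul : ∀ f ∈ weierstrassIdeal a b, f * dualForm c l' ∈ powIdeal k (p ^ e) Set.univ := by
      intro f hf
      rw [mem_powIdeal]
      intro τ hτ
      by_contra! h
      rw [mem_support_iff, coeff_mul_dualForm hl'c f (fun i => by
        have := h i (Set.mem_univ i)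
        simp [c]
        omega)] at hτ
      exact hτ (hl'K _ (Ideal.mul_mem_right _ _ (Ideal.mem_sup_left hf)))
    have hdeg : m ≤ c.degree := by
      rw [← hμ]
      exact Finsupp.degree_mono hμc
    have hmem := mem_powIdeal_of_mul_mem_powIdeal p e h3 hb hab (by omega) (by omega)
      (isHomogeneous_dualForm hl'd) (hmul _ (Ideal.subset_span (by simp)))
      (hmul _ (Ideal.subset_span (by simp)))
    rw [mem_powIdeal] at hmem
    obtain ⟨i, -, hi⟩ := hmem (c - μ) (by
      rwa [mem_support_iff, coeff_dualForm, if_pos tsub_le_self, tsub_tsub_cancel_of_le hμc])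
    simp [c] at hi
    omega
  rw [x.as_sum]
  refine sum_mem fun μ hμ => ?_
  rw [← mul_one (coeff μ x), ← C_mul_monomial]
  refine Ideal.mul_mem_left _ _ (hmon μ ?_)
  have := hx (mem_support_iff.1 hμ)
  rwa [show (Finsupp.weight (1 : Fin 4 → ℕ)) μ = μ.degree from
      (DFunLike.congr_fun Finsupp.degree_eq_weight_one μ).symm] at this

end FrobeniusQuotient

section Count

variable {σ k : Type*} [Field k]

/-- The sum of the homogeneous components of degree at most `M`. -/
noncomputable def MvPolynomial.truncateDegree (M : ℕ) :
    MvPolynomial σ k →ₗ[k] MvPolynomial σ k :=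
  ∑ n ∈ Finset.range (M + 1), homogeneousComponent n

theorem MvPolynomial.truncateDegree_apply (M : ℕ) (x : MvPolynomial σ k) :
    truncateDegree M x = ∑ n ∈ Finset.range (M + 1), homogeneousComponent n x := by
  simp [truncateDegree]

theorem MvPolynomial.truncateDegree_eq_self {M : ℕ} {x : MvPolynomial σ k}
    (hx : x.totalDegree ≤ M) : truncateDegree M x = x := by
  rw [truncateDegree_apply]
  conv_rhs => rw [← sum_homogeneousComponent x]
  refine (Finset.sum_subset (Finset.range_mono (by omega)) fun n _ hn => ?_).symm
  exact homogeneousComponent_eq_zero _ _ (by simpa using hn)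

theorem MvPolynomial.totalDegree_truncateDegree_le (M : ℕ) (x : MvPolynomial σ k) :
    (truncateDegree M x).totalDegree ≤ M := by
  rw [truncateDegree_apply]
  refine totalDegree_finsetSum_le fun n hn => ?_
  exact (homogeneousComponent_isHomogeneous n x).totalDegree_le.trans
    (by rw [Finset.mem_range] at hn; omega)

theorem MvPolynomial.truncateDegree_mul_X_pow {M q : ℕ} (hq : q ≤ M) (x : MvPolynomial σ k)
    (i : σ) : truncateDegree M (x * X i ^ q) = truncateDegree (M - q) x * X i ^ q := by
  obtain ⟨N, rfl⟩ := Nat.exists_eq_add_of_le hq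
  rw [truncateDegree_apply, truncateDegree_apply, add_assoc, Finset.sum_range_add,
    Finset.sum_eq_zero, zero_add, Finset.sum_mul, add_tsub_cancel_left]
  · refine Finset.sum_congr rfl fun n _ => ?_
    rw [mul_comm, homogeneousComponent_mul_of_isHomogeneous (isHomogeneous_X_pow i q),
      if_pos (by omega), add_tsub_cancel_left, mul_comm]
  · intro n hn
    rw [Finset.mem_range] at hn
    rw [mul_comm, homogeneousComponent_mul_of_isHomogeneous (isHomogeneous_X_pow i q),
      if_neg (by omega)]

theorem weierstrassIdeal_le_frobeniusIdeal (a b : k) (q : ℕ) :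
    weierstrassIdeal a b ≤ frobeniusIdeal a b q := le_sup_left

theorem mem_frobeniusIdeal_iff {a b : k} {q : ℕ} {x : MvPolynomial (Fin 4) k} :
    x ∈ frobeniusIdeal a b q ↔ ∃ y : Fin 4 → MvPolynomial (Fin 4) k,
      x - ∑ i, y i * X i ^ q ∈ weierstrassIdeal a b := by
  rw [frobeniusIdeal]
  constructor
  · intro h
    obtain ⟨j, hj, z, hz, rfl⟩ := Submodule.mem_sup.1 h
    rw [powIdeal, Set.image_univ, Ideal.mem_span_range_iff_exists_fun] at hz
    obtain ⟨y, rfl⟩ := hz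
    exact ⟨y, by simpa using hj⟩
  · rintro ⟨y, hy⟩
    rw [← sub_add_cancel x (∑ i, y i * X i ^ q)]
    exact add_mem (Ideal.mem_sup_left hy) (Ideal.mem_sup_right
      (sum_mem fun i _ => Ideal.mul_mem_left _ _ (X_pow_mem_powIdeal (Set.mem_univ i))))

theorem truncateDegree_mem_weierstrassIdeal {a b : k} {x : MvPolynomial (Fin 4) k}
    (hx : x ∈ weierstrassIdeal a b) (M : ℕ) : truncateDegree M x ∈ weierstrassIdeal a b := by
  rw [truncateDegree_apply]
  exact sum_mem fun n _ => Ideal.isHomogeneous_span_of_mvPolynomial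
    (isHomogeneous_of_mem_weierstrassIdeal_gens a b) hx n

/-- Multiplication by the `q`-th powers of the variables on the coordinate ring. -/
noncomputable def frobeniusSyzygyMap (a b : k) (q N : ℕ) :
    (Fin 4 → coordinateRingLE a b N) →ₗ[k] MvPolynomial (Fin 4) k ⧸ weierstrassIdeal a b :=
  ∑ i, (LinearMap.mulRight k (Ideal.Quotient.mk (weierstrassIdeal a b) (X i ^ q))) ∘ₗ
    (coordinateRingLE a b N).subtype ∘ₗ LinearMap.proj i

theorem frobeniusSyzygyMap_apply {a b : k} {q N : ℕ} (r : Fin 4 → coordinateRingLE a b N) :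
    frobeniusSyzygyMap a b q N r =
      ∑ i, (r i : MvPolynomial (Fin 4) k ⧸ weierstrassIdeal a b) *
        Ideal.Quotient.mk (weierstrassIdeal a b) (X i ^ q) := by
  simp [frobeniusSyzygyMap]

variable [IsAlgClosed k] {a b : k} (p e : ℕ) [Fact p.Prime] [CharP k p]

theorem frobeniusSyzygyMap_injective (h3 : (3 : k) ≠ 0) (hb : b ≠ 0) (hab : b - a ^ 3 ≠ 0)
    {N : ℕ} (hN : 3 * N < p ^ e) : Function.Injective (frobeniusSyzygyMap a b (p ^ e) N) := by
  rw [← LinearMap.ker_eq_bot, LinearMap.ker_eq_bot']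
  intro r hr
  choose x hx hxr using fun i => (r i).2
  have hrel : ∑ i, x i * X i ^ p ^ e ∈ weierstrassIdeal a b := by
    rw [← Ideal.Quotient.eq_zero_iff_mem, map_sum, ← hr, frobeniusSyzygyMap_apply]
    refine Finset.sum_congr rfl fun i _ => ?_
    rw [map_mul, ← hxr]
    rfl
  have hmem : ∀ n i, homogeneousComponent n (x i) ∈ weierstrassIdeal a b := by
    intro n i
    by_cases hn : N < n
    · rw [homogeneousComponent_eq_zero _ _
        (((mem_restrictTotalDegree _ _ _).1 (hx i)).trans_lt hn)]
      exact zero_mem _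
    refine mem_weierstrassIdeal_of_syzygy p e h3 hb hab (d := n) (by omega)
      (fun i => homogeneousComponent_isHomogeneous n (x i)) ?_ i
    have := Ideal.isHomogeneous_span_of_mvPolynomial
      (isHomogeneous_of_mem_weierstrassIdeal_gens a b) hrel (p ^ e + n)
    simp only [map_sum] at this
    rw [← weierstrassIdeal] at this
    refine (congrArg (· ∈ weierstrassIdeal a b) (Finset.sum_congr rfl fun i _ => ?_)).mp this
    rw [mul_comm (x i), homogeneousComponent_mul_of_isHomogeneous (isHomogeneous_X_pow i _),
      if_pos (by omega), add_tsub_cancel_left, mul_comm]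
  ext i
  rw [Pi.zero_apply, ZeroMemClass.coe_zero, ← hxr]
  change Ideal.Quotient.mk _ (x i) = 0
  rw [Ideal.Quotient.eq_zero_iff_mem, ← sum_homogeneousComponent (x i)]
  exact sum_mem fun n _ => hmem n i

omit [IsAlgClosed k] in
theorem range_frobeniusSyzygyMap {q M : ℕ} (hq : q ≤ M) :
    LinearMap.range (frobeniusSyzygyMap a b q (M - q)) = coordinateRingLE a b M ⊓
      LinearMap.ker (Ideal.Quotient.factorₐ k
        (weierstrassIdeal_le_frobeniusIdeal a b q)).toLinearMap := by
  have hmk (x : MvPolynomial (Fin 4) k) : (Ideal.Quotient.factorₐ k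
        (weierstrassIdeal_le_frobeniusIdeal a b q)).toLinearMap (Ideal.Quotient.mk _ x) =
      Ideal.Quotient.mk _ x := rfl
  have hsum (y : Fin 4 → MvPolynomial (Fin 4) k) :
      ∑ i, Ideal.Quotient.mk (weierstrassIdeal a b) (y i) *
        Ideal.Quotient.mk (weierstrassIdeal a b) (X i ^ q) =
      Ideal.Quotient.mk _ (∑ i, y i * X i ^ q) := by simp
  apply le_antisymm
  · rintro _ ⟨r, rfl⟩
    choose x hx hxr using fun i => (r i).2
    have hr : frobeniusSyzygyMap a b q (M - q) r =
        Ideal.Quotient.mk _ (∑ i, x i * X i ^ q) := by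
      rw [frobeniusSyzygyMap_apply, ← hsum]
      simp only [← hxr]
      rfl
    rw [hr]
    refine ⟨mk_mem_coordinateRingLE (totalDegree_finsetSum_le fun i _ => ?_), ?_⟩
    · have h1 := (mem_restrictTotalDegree _ _ _).1 (hx i)
      exact (totalDegree_mul _ _).trans (by rw [totalDegree_X_pow]; omega)
    · rw [SetLike.mem_coe, LinearMap.mem_ker, hmk, Ideal.Quotient.eq_zero_iff_mem,
        mem_frobeniusIdeal_iff]
      exact ⟨x, by simp⟩
  · rintro _ ⟨⟨x, hx, rfl⟩, h⟩
    rw [SetLike.mem_coe, mem_restrictTotalDegree] at hx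
    change Ideal.Quotient.mk _ x ∈ _ at h
    change Ideal.Quotient.mk _ x ∈ _
    rw [SetLike.mem_coe, LinearMap.mem_ker, hmk, Ideal.Quotient.eq_zero_iff_mem,
      mem_frobeniusIdeal_iff] at h
    obtain ⟨y, hy⟩ := h
    refine ⟨fun i => ⟨_, mk_mem_coordinateRingLE
      (totalDegree_truncateDegree_le (M - q) (y i))⟩, ?_⟩
    rw [frobeniusSyzygyMap_apply, hsum, eq_comm, Ideal.Quotient.eq]
    have := truncateDegree_mem_weierstrassIdeal hy M
    simpa only [map_sub, map_sum, truncateDegree_mul_X_pow hq, truncateDegree_eq_self hx] using this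

theorem finrank_quotient_frobeniusIdeal (hp3 : p ≠ 3) (hb : b ≠ 0)
    (hab : b - a ^ 3 ≠ 0) :
    (3 * Module.finrank k (MvPolynomial (Fin 4) k ⧸ frobeniusIdeal a b (p ^ e)) : ℤ) =
      8 * ((p : ℤ) ^ e) ^ 2 - 5 := by
  have hpp : p.Prime := Fact.out
  have hdvd : ¬ 3 ∣ p ^ e := fun h =>
    hp3 ((Nat.prime_dvd_prime_iff_eq Nat.prime_three hpp).1 (Nat.prime_three.dvd_of_dvd_pow h)).symm
  have h3 : (3 : k) ≠ 0 := by
    intro h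
    have := (CharP.cast_eq_zero_iff k p 3).1 (by exact_mod_cast h)
    exact hp3 ((Nat.prime_dvd_prime_iff_eq hpp Nat.prime_three).1 this)
  have hq0 : 0 < p ^ e := Nat.pow_pos hpp.pos
  have hcast : ((p : ℤ) ^ e) = ((p ^ e : ℕ) : ℤ) := by push_cast; rfl
  rw [hcast]
  set q := p ^ e with hqdef
  set M := 4 * q / 3 with hM
  let ρ := (Ideal.Quotient.factorₐ k
    (weierstrassIdeal_le_frobeniusIdeal a b q)).toLinearMap
  have hfd (N : ℕ) : Module.Finite k (coordinateRingLE a b N) :=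
    Module.finite_of_finrank_pos (by rw [finrank_coordinateRingLE hb]; omega)
  have hsurj : LinearMap.range (ρ.domRestrict (coordinateRingLE a b M)) = ⊤ := by
    rw [eq_top_iff]
    rintro z -
    obtain ⟨x, rfl⟩ := Ideal.Quotient.mk_surjective z
    refine ⟨⟨_, mk_mem_coordinateRingLE (totalDegree_truncateDegree_le M x)⟩, ?_⟩
    change Ideal.Quotient.mk _ (truncateDegree M x) = _
    rw [eq_comm, Ideal.Quotient.eq]
    have hx := truncateDegree_eq_self (le_max_left x.totalDegree M)
    rw [truncateDegree_apply, ← Finset.sum_range_add_sum_Ico _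
      (show M + 1 ≤ max x.totalDegree M + 1 by omega), ← truncateDegree_apply] at hx
    nth_rewrite 1 [← hx]
    rw [add_sub_cancel_left]
    refine sum_mem fun n hn => mem_frobeniusIdeal_of_isHomogeneous p e h3 hb hab (m := n) ?_
      (homogeneousComponent_isHomogeneous n x)
    rw [Finset.mem_Ico] at hn
    omega
  have hker : Module.finrank k (LinearMap.ker (ρ.domRestrict (coordinateRingLE a b M))) =
      4 * (1 + 2 * (M - q) * (M - q + 1)) := by
    rw [LinearMap.ker_domRestrict]
    have h1 := LinearMap.finrank_range_of_inj
      (frobeniusSyzygyMap_injective (a := a) (b := b) p e h3 hb hab (N := M - q) (by omega))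
    rw [← hqdef, range_frobeniusSyzygyMap (by omega)] at h1
    rw [Module.finrank_pi_fintype] at h1
    simp only [finrank_coordinateRingLE hb, Finset.sum_const, Finset.card_univ, Fintype.card_fin,
      smul_eq_mul] at h1
    rw [← h1]
    rw [← Submodule.finrank_map_subtype_eq, Submodule.map_comap_subtype]
  have hrn := LinearMap.finrank_range_add_finrank_ker (ρ.domRestrict (coordinateRingLE a b M))
  rw [hsurj, hker, finrank_coordinateRingLE hb, finrank_top] at hrn
  generalize Module.finrank k (MvPolynomial (Fin 4) k ⧸ frobeniusIdeal a b q) = D at *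
  obtain ⟨t, ht | ht⟩ : ∃ t, q = 3 * t + 1 ∨ q = 3 * t + 2 := ⟨q / 3, by omega⟩
  · have hM' : M = 4 * t + 1 := by omega
    have hMq : M - q = t := by omega
    rw [hMq, hM'] at hrn
    rw [ht]
    zify at hrn
    push_cast
    linear_combination 3 * hrn
  · have hM' : M = 4 * t + 2 := by omega
    have hMq : M - q = t := by omega
    rw [hMq, hM'] at hrn
    rw [ht]
    zify at hrn
    push_cast
    linear_combination 3 * hrn

end Count

section Pencil

variable {k : Type*} [Field k]

/-- Two pencils of functions on `k⁴` agree up to linear changes of coordinates and of generators. -/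
def PencilEquiv (F G F' G' : (Fin 4 → k) → k) : Prop :=
  ∃ (L : (Fin 4 → k) ≃ₗ[k] (Fin 4 → k)) (c : Fin 4 → k), c 0 * c 3 - c 1 * c 2 ≠ 0 ∧
    ∀ x, F' x = c 0 * F (L x) + c 1 * G (L x) ∧ G' x = c 2 * F (L x) + c 3 * G (L x)

theorem PencilEquiv.trans {F G F' G' F'' G'' : (Fin 4 → k) → k}
    (h : PencilEquiv F G F' G') (h' : PencilEquiv F' G' F'' G'') :
    PencilEquiv F G F'' G'' := by
  obtain ⟨L, c, hc, h⟩ := h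
  obtain ⟨L', c', hc', h'⟩ := h'
  refine ⟨L'.trans L, ![c' 0 * c 0 + c' 1 * c 2, c' 0 * c 1 + c' 1 * c 3,
    c' 2 * c 0 + c' 3 * c 2, c' 2 * c 1 + c' 3 * c 3], ?_, fun x => ⟨?_, ?_⟩⟩
  · convert mul_ne_zero hc hc' using 1
    simp
    ring
  · simp only [(h' x).1, (h (L' x)).1, (h (L' x)).2, LinearEquiv.trans_apply]
    simp
    ring
  · simp only [(h' x).2, (h (L' x)).1, (h (L' x)).2, LinearEquiv.trans_apply]
    simp
    ring

theorem PencilEquiv.of_linearEquiv {F G F' G' : (Fin 4 → k) → k}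
    (L : (Fin 4 → k) ≃ₗ[k] (Fin 4 → k)) (hF : ∀ x, F' x = F (L x)) (hG : ∀ x, G' x = G (L x)) :
    PencilEquiv F G F' G' :=
  ⟨L, ![1, 0, 0, 1], by simp, fun x => by simp [hF, hG]⟩

theorem PencilEquiv.of_coeffs {F G F' G' : (Fin 4 → k) → k} (c : Fin 4 → k)
    (hc : c 0 * c 3 - c 1 * c 2 ≠ 0) (hF : ∀ x, F' x = c 0 * F x + c 1 * G x)
    (hG : ∀ x, G' x = c 2 * F x + c 3 * G x) :
    PencilEquiv F G F' G' :=
  ⟨LinearEquiv.refl _ _, c, hc, fun x => ⟨hF x, hG x⟩⟩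

/-- The common zeros of `F` and `G` away from the origin are nonsingular. -/
def SmoothPencil (F G : (Fin 4 → k) → k) : Prop :=
  ∀ a, a ≠ 0 → F a = 0 → G a = 0 → ∀ s t : k,
    (∀ v, s * QuadraticMap.polar F a v + t * QuadraticMap.polar G a v = 0) → s = 0 ∧ t = 0

theorem SmoothPencil.of_pencilEquiv {F G F' G' : (Fin 4 → k) → k} (hS : SmoothPencil F G)
    (h : PencilEquiv F G F' G') : SmoothPencil F' G' := by
  obtain ⟨L, c, hc, h⟩ := h
  intro a ha hFa hGa s t hst
  rw [(h a).1] at hFa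
  rw [(h a).2] at hGa
  have hF : F (L a) = 0 := by
    refine (mul_eq_zero.1 ?_).resolve_left hc
    linear_combination c 3 * hFa - c 1 * hGa
  have hG : G (L a) = 0 := by
    refine (mul_eq_zero.1 ?_).resolve_left hc
    linear_combination c 0 * hGa - c 2 * hFa
  obtain ⟨h1, h2⟩ := hS (L a) (by simpa using ha) hF hG (s * c 0 + t * c 2) (s * c 1 + t * c 3) (by
    intro v
    have := hst (L.symm v)
    simp only [QuadraticMap.polar, h, map_add, LinearEquiv.apply_symm_apply] at this ⊢
    linear_combination this)
  constructor
  · refine (mul_eq_zero.1 ?_).resolve_left hc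
    linear_combination c 3 * h1 - c 2 * h2
  · refine (mul_eq_zero.1 ?_).resolve_left hc
    linear_combination c 0 * h2 - c 1 * h1

/-- The linear change of coordinates on polynomials. -/
noncomputable def linearSubst (L : (Fin 4 → k) →ₗ[k] (Fin 4 → k)) :
    MvPolynomial (Fin 4) k →ₐ[k] MvPolynomial (Fin 4) k :=
  aeval fun i => ∑ j, C (L (Pi.single j 1) i) * X j

theorem eval_linearSubst (L : (Fin 4 → k) →ₗ[k] (Fin 4 → k)) (x : Fin 4 → k)
    (f : MvPolynomial (Fin 4) k) : eval x (linearSubst L f) = eval (L x) f := by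
  have hL : L x = fun i => ∑ j, L (Pi.single j 1) i * x j := by
    conv_lhs => rw [pi_eq_sum_univ' x]
    ext i
    simp [mul_comm]
  induction f using MvPolynomial.induction_on with
  | C r => simp [linearSubst]
  | add f g hf hg => simp [hf, hg]
  | mul_X f i hf =>
    rw [map_mul, map_mul, map_mul, hf]
    simp [linearSubst, hL]

theorem linearSubst_mem_powIdeal (p e : ℕ) [Fact p.Prime] [CharP k p]
    (L : (Fin 4 → k) →ₗ[k] (Fin 4 → k)) (i : Fin 4) :
    linearSubst L (X i ^ p ^ e) ∈ powIdeal k (p ^ e) Set.univ := by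
  rw [map_pow, linearSubst, aeval_X, sum_pow_char_pow]
  refine sum_mem fun j _ => ?_
  rw [mul_pow]
  exact Ideal.mul_mem_left _ _ (X_pow_mem_powIdeal (Set.mem_univ j))

/-- A linear change of coordinates as an algebra automorphism. -/
noncomputable def linearSubstEquiv [Infinite k] (L : (Fin 4 → k) ≃ₗ[k] (Fin 4 → k)) :
    MvPolynomial (Fin 4) k ≃ₐ[k] MvPolynomial (Fin 4) k :=
  AlgEquiv.ofAlgHom (linearSubst L.toLinearMap) (linearSubst L.symm.toLinearMap)
    (AlgHom.ext fun f => MvPolynomial.funext fun x => by simp [eval_linearSubst])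
    (AlgHom.ext fun f => MvPolynomial.funext fun x => by simp [eval_linearSubst])

theorem finrank_quotient_eq_of_pencilEquiv [Infinite k] (p e : ℕ) [Fact p.Prime] [CharP k p]
    {f g : MvPolynomial (Fin 4) k} {a b : k}
    (h : PencilEquiv (fun x => eval x f) (fun x => eval x g) (fun x => eval x (conicForm k))
      (fun x => eval x (weierstrassForm a b))) :
    Module.finrank k (MvPolynomial (Fin 4) k ⧸
      Ideal.span {f, g, X 0 ^ p ^ e, X 1 ^ p ^ e, X 2 ^ p ^ e, X 3 ^ p ^ e}) =
    Module.finrank k (MvPolynomial (Fin 4) k ⧸ frobeniusIdeal a b (p ^ e)) := by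
  obtain ⟨L, c, hc, h⟩ := h
  have hF : conicForm k = C (c 0) * linearSubst L.toLinearMap f +
      C (c 1) * linearSubst L.toLinearMap g :=
    MvPolynomial.funext fun x => by simp [eval_linearSubst, (h x).1]
  have hG : weierstrassForm a b = C (c 2) * linearSubst L.toLinearMap f +
      C (c 3) * linearSubst L.toLinearMap g :=
    MvPolynomial.funext fun x => by simp [eval_linearSubst, (h x).2]
  have hinv : C (c 0 * c 3 - c 1 * c 2)⁻¹ * (C (c 0) * C (c 3) - C (c 1) * C (c 2)) =
      (1 : MvPolynomial (Fin 4) k) := by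
    simp only [← C_mul, ← C_sub, inv_mul_cancel₀ hc, C_1]
  have hf : linearSubst L.toLinearMap f = C (c 0 * c 3 - c 1 * c 2)⁻¹ *
      (C (c 3) * conicForm k - C (c 1) * weierstrassForm a b) := by
    rw [hF, hG]
    linear_combination (-linearSubst L.toLinearMap f) * hinv
  have hg : linearSubst L.toLinearMap g = C (c 0 * c 3 - c 1 * c 2)⁻¹ *
      (C (c 0) * weierstrassForm a b - C (c 2) * conicForm k) := by
    rw [hF, hG]
    linear_combination (-linearSubst L.toLinearMap g) * hinv
  have hconic : conicForm k ∈ frobeniusIdeal a b (p ^ e) :=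
    Ideal.mem_sup_left (Ideal.subset_span (by simp))
  have hweier : weierstrassForm a b ∈ frobeniusIdeal a b (p ^ e) :=
    Ideal.mem_sup_left (Ideal.subset_span (by simp))
  set I := Ideal.span {f, g, X 0 ^ p ^ e, X 1 ^ p ^ e, X 2 ^ p ^ e, X 3 ^ p ^ e} with hI
  have hpowI : powIdeal k (p ^ e) Set.univ ≤ I := by
    refine Ideal.span_le.2 ?_
    rintro _ ⟨i, -, rfl⟩
    refine Ideal.subset_span ?_
    fin_cases i <;> simp
  have hfI : f ∈ I := Ideal.subset_span (by simp)
  have hgI : g ∈ I := Ideal.subset_span (by simp)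
  have hle : I ≤ (frobeniusIdeal a b (p ^ e)).comap (linearSubst L.toLinearMap) := by
    refine Ideal.span_le.2 ?_
    have hpow (i : Fin 4) : linearSubst L.toLinearMap (X i ^ p ^ e) ∈ frobeniusIdeal a b (p ^ e) :=
      Ideal.mem_sup_right (linearSubst_mem_powIdeal p e _ i)
    rintro x (rfl | rfl | rfl | rfl | rfl | rfl)
    · rw [SetLike.mem_coe, Ideal.mem_comap, hf]
      exact Ideal.mul_mem_left _ _
        (sub_mem (Ideal.mul_mem_left _ _ hconic) (Ideal.mul_mem_left _ _ hweier))
    · rw [SetLike.mem_coe, Ideal.mem_comap, hg]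
      exact Ideal.mul_mem_left _ _
        (sub_mem (Ideal.mul_mem_left _ _ hweier) (Ideal.mul_mem_left _ _ hconic))
    all_goals exact hpow _
  have hge : frobeniusIdeal a b (p ^ e) ≤ I.comap (linearSubst L.symm.toLinearMap) := by
    have hsymm (x : MvPolynomial (Fin 4) k) :
        linearSubst L.symm.toLinearMap (linearSubst L.toLinearMap x) = x :=
      (linearSubstEquiv L).symm_apply_apply x
    refine sup_le (Ideal.span_le.2 ?_) (Ideal.span_le.2 ?_)
    · rintro x (rfl | rfl)
      · rw [SetLike.mem_coe, Ideal.mem_comap, hF, map_add, map_mul, map_mul, hsymm, hsymm]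
        exact add_mem (Ideal.mul_mem_left _ _ hfI) (Ideal.mul_mem_left _ _ hgI)
      · rw [SetLike.mem_coe, Ideal.mem_comap, hG, map_add, map_mul, map_mul, hsymm, hsymm]
        exact add_mem (Ideal.mul_mem_left _ _ hfI) (Ideal.mul_mem_left _ _ hgI)
    · rintro _ ⟨i, -, rfl⟩
      exact hpowI (linearSubst_mem_powIdeal p e _ i)
  refine LinearEquiv.finrank_eq (Ideal.quotientEquivAlg _ _ (linearSubstEquiv L) ?_).toLinearEquiv
  refine le_antisymm (fun x hx => ?_) (Ideal.map_le_iff_le_comap.2 hle)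
  exact (Ideal.mem_map_of_equiv (linearSubstEquiv L) x).2
    ⟨_, hge hx, (linearSubstEquiv L).apply_symm_apply x⟩

end Pencil

section Weierstrass

variable {k : Type*} [Field k]

/-- The conic cone as a function on `k⁴`. -/
def conicFun (x : Fin 4 → k) : k := x 0 * x 3 - x 1 ^ 2

/-- The quadric which cuts out the Weierstrass curve with coefficients `a₁, a₂, a₃, a₄, a₆`
on the conic cone. -/
def weierstrassFun (a₁ a₂ a₃ a₄ a₆ : k) (x : Fin 4 → k) : k :=
  x 2 ^ 2 + a₁ * x 1 * x 2 + a₃ * x 0 * x 2 - x 1 * x 3 - a₂ * x 1 ^ 2 - a₄ * x 0 * x 1 -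
    a₆ * x 0 ^ 2

/-- The linear change of coordinates induced by the change of variables
`(x, y) ↦ (x + r, y + s x + t)` of Weierstrass curves. -/
def weierstrassChange (r s t : k) : (Fin 4 → k) ≃ₗ[k] (Fin 4 → k) where
  toFun x := ![x 0, x 1 + r * x 0, x 2 + s * x 1 + t * x 0, x 3 + 2 * r * x 1 + r ^ 2 * x 0]
  invFun x := ![x 0, x 1 - r * x 0, x 2 - s * x 1 + (s * r - t) * x 0,
    x 3 - 2 * r * x 1 + r ^ 2 * x 0]
  map_add' x y := by
    ext i
    fin_cases i <;> simp <;> ring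
  map_smul' c x := by
    ext i
    fin_cases i <;> simp <;> ring
  left_inv x := by
    ext i
    fin_cases i <;> simp <;> ring
  right_inv x := by
    ext i
    fin_cases i <;> simp <;> ring

theorem SmoothPencil.ne_zero_of_threeTorsion {a b : k}
    (h : SmoothPencil conicFun (weierstrassFun (3 * a) 0 b 0 0)) : b - a ^ 3 ≠ 0 := by
  intro hb
  rw [sub_eq_zero] at hb
  subst hb
  have := h ![1, -a ^ 2, a ^ 3, a ^ 4] (fun h => one_ne_zero (congrFun h 0))
    (by simp [conicFun]; ring) (by simp [weierstrassFun]; ring) (a ^ 2) (-1) (by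
      intro v
      simp [QuadraticMap.polar, conicFun, weierstrassFun]
      ring)
  exact neg_ne_zero.2 one_ne_zero this.2

theorem pencilEquiv_weierstrassFun {a₁ a₂ a₃ a₄ a₆ r s t : k}
    (h₂ : s ^ 2 + a₁ * s = a₂ + 3 * r)
    (h₄ : s * (2 * t + a₁ * r + a₃) = a₄ + 2 * a₂ * r + 3 * r ^ 2 - a₁ * t)
    (h₆ : t ^ 2 + a₁ * r * t + a₃ * t = r ^ 3 + a₂ * r ^ 2 + a₄ * r + a₆) :
    PencilEquiv conicFun (weierstrassFun a₁ a₂ a₃ a₄ a₆) conicFun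
      (weierstrassFun (2 * s + a₁) 0 (2 * t + a₁ * r + a₃) 0 0) := by
  refine ⟨weierstrassChange r s t, ![1, 0, r, 1], by simp, fun x => ⟨?_, ?_⟩⟩
  · simp [conicFun, weierstrassChange]
    ring
  · simp [conicFun, weierstrassFun, weierstrassChange]
    linear_combination (-x 1 ^ 2) * h₂ - x 0 * x 1 * h₄ - x 0 ^ 2 * h₆

theorem exists_monic_quadratic_eq_zero [IsAlgClosed k] (b c : k) :
    ∃ y : k, y ^ 2 + b * y + c = 0 := by
  have hdeg : (.X ^ 2 + .C b * .X + .C c : Polynomial k).degree = 2 := by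
    compute_degree!
  obtain ⟨y, hy⟩ := IsAlgClosed.exists_root _ (by rw [hdeg]; decide)
  exact ⟨y, by simpa using hy⟩

theorem SmoothPencil.exists_threeTorsion [IsAlgClosed k] (h3 : (3 : k) ≠ 0) {a₁ a₂ a₃ a₄ a₆ : k}
    (h : SmoothPencil conicFun (weierstrassFun a₁ a₂ a₃ a₄ a₆)) :
    ∃ a b : k, b ≠ 0 ∧ b - a ^ 3 ≠ 0 ∧
      PencilEquiv conicFun (weierstrassFun a₁ a₂ a₃ a₄ a₆) conicFun
        (weierstrassFun (3 * a) 0 b 0 0) := by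
  have hroot : ∃ r : k, 3 * r ^ 4 + (a₁ ^ 2 + 4 * a₂) * r ^ 3 + 3 * (2 * a₄ + a₁ * a₃) * r ^ 2 +
      3 * (a₃ ^ 2 + 4 * a₆) * r +
      (a₁ ^ 2 * a₆ + 4 * a₂ * a₆ - a₁ * a₃ * a₄ + a₂ * a₃ ^ 2 - a₄ ^ 2) = 0 := by
    have hdeg := (WeierstrassCurve.natDegree_Ψ₃ (W := ⟨a₁, a₂, a₃, a₄, a₆⟩) h3)
    obtain ⟨r, hr⟩ := IsAlgClosed.exists_root (WeierstrassCurve.Ψ₃ ⟨a₁, a₂, a₃, a₄, a₆⟩)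
      (fun h0 => by
        rw [Polynomial.natDegree_eq_of_degree_eq_some h0] at hdeg
        exact absurd hdeg (by decide))
    refine ⟨r, ?_⟩
    simpa [WeierstrassCurve.Ψ₃, WeierstrassCurve.b₂, WeierstrassCurve.b₄, WeierstrassCurve.b₆,
      WeierstrassCurve.b₈, Polynomial.IsRoot] using hr
  obtain ⟨r, hr⟩ := hroot
  obtain ⟨t, ht⟩ : ∃ t : k, t ^ 2 + a₁ * r * t + a₃ * t = r ^ 3 + a₂ * r ^ 2 + a₄ * r + a₆ := by
    obtain ⟨t, ht⟩ := exists_monic_quadratic_eq_zero (a₁ * r + a₃)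
      (-(r ^ 3 + a₂ * r ^ 2 + a₄ * r + a₆))
    exact ⟨t, by linear_combination ht⟩
  set D := 2 * t + a₁ * r + a₃ with hD
  set A := a₄ + 2 * a₂ * r + 3 * r ^ 2 - a₁ * t with hA
  have key : A ^ 2 + a₁ * A * D = (a₂ + 3 * r) * D ^ 2 := by
    rw [hA, hD]
    linear_combination (-1) * hr + (-(4 * (a₂ + 3 * r)) - a₁ ^ 2) * ht
  have hD0 : D ≠ 0 := by
    intro h0
    rw [h0] at key
    have hA0 : A = 0 := by simpa using key
    have := h ![1, r, t, r ^ 2] (fun h => one_ne_zero (congrFun h 0))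
      (by simp [conicFun]) (by simp [weierstrassFun]; linear_combination ht) r 1 (by
        intro v
        simp [QuadraticMap.polar, conicFun, weierstrassFun]
        linear_combination (v 2 - t * v 0) * h0 + (r * v 0 - v 1) * hA0 + 2 * v 0 * ht)
    exact one_ne_zero this.2
  have hE := pencilEquiv_weierstrassFun (s := A / D) (a₁ := a₁) (a₂ := a₂) (a₃ := a₃) (a₄ := a₄)
    (a₆ := a₆) (r := r) (t := t) (by field_simp; linear_combination key)
    (by rw [← hD, div_mul_cancel₀ _ hD0]) ht
  have ha : 2 * (A / D) + a₁ = 3 * ((2 * (A / D) + a₁) / 3) := by field_simp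
  rw [ha] at hE
  exact ⟨_, _, hD0, (h.of_pencilEquiv hE).ne_zero_of_threeTorsion, hE⟩

/-- A diagonal linear change of coordinates. -/
def diagonalChange (c : k) (hc : c ≠ 0) : (Fin 4 → k) ≃ₗ[k] (Fin 4 → k) where
  toFun x := ![x 0, c * x 1, x 2, c ^ 2 * x 3]
  invFun x := ![x 0, c⁻¹ * x 1, x 2, (c ^ 2)⁻¹ * x 3]
  map_add' x y := by
    ext i
    fin_cases i <;> simp <;> ring
  map_smul' r x := by
    ext i
    fin_cases i <;> simp <;> ring
  left_inv x := by
    ext i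
    fin_cases i <;> simp [hc]
  right_inv x := by
    ext i
    fin_cases i <;> simp [hc]

/-- A quadric through the point `(0,0,0,1)` of the conic cone at which the ruling is tangent to
the quadric can be brought into Weierstrass form. -/
theorem SmoothPencil.exists_weierstrassFun [IsAlgClosed k] {c₁₂ c₀₂ c₁₃ c₀₃ c₁₁ c₀₁ c₀₀ : k}
    {G : (Fin 4 → k) → k}
    (hG : ∀ x, G x = x 2 ^ 2 + c₁₂ * x 1 * x 2 + c₀₂ * x 0 * x 2 + c₁₃ * x 1 * x 3 +
      c₀₃ * x 0 * x 3 + c₁₁ * x 1 ^ 2 + c₀₁ * x 0 * x 1 + c₀₀ * x 0 ^ 2)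
    (h : SmoothPencil conicFun G) :
    ∃ a₁ a₂ a₃ a₄ a₆ : k, PencilEquiv conicFun G conicFun (weierstrassFun a₁ a₂ a₃ a₄ a₆) := by
  have hc : c₁₃ ≠ 0 := by
    intro h0
    have := h (Pi.single 3 1) (by simp) (by simp [conicFun]) (by simp [hG]) (-c₀₃) 1 (by
      intro v
      simp [QuadraticMap.polar, conicFun, hG, h0]
      ring)
    exact one_ne_zero this.2
  obtain ⟨κ, hκ⟩ := IsAlgClosed.exists_pow_nat_eq (-c₁₃⁻¹) (show 0 < 3 by norm_num)
  have hκ0 : κ ≠ 0 := by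
    rintro rfl
    simp [hc] at hκ
  have hκ' : κ ^ 3 * c₁₃ = -1 := by rw [hκ]; field_simp
  refine ⟨c₁₂ * κ, -(c₁₁ + c₀₃) * κ ^ 2, c₀₂, -c₀₁ * κ, -c₀₀, diagonalChange κ hκ0,
    ![(κ ^ 2)⁻¹, 0, -c₀₃, 1], by simp [hκ0], fun x => ⟨?_, ?_⟩⟩
  · simp [conicFun, diagonalChange]
    field_simp
  · simp [conicFun, weierstrassFun, diagonalChange, hG]
    linear_combination (-x 1 * x 3) * hκ'

end Weierstrass

section QuadraticForms

variable {k : Type*} [Field k]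

theorem QuadraticForm.apply_fin_four (H : QuadraticForm k (Fin 4 → k)) (x : Fin 4 → k) :
    H x = H (Pi.single 0 1) * x 0 ^ 2 + H (Pi.single 1 1) * x 1 ^ 2 + H (Pi.single 2 1) * x 2 ^ 2 +
      H (Pi.single 3 1) * x 3 ^ 2 +
      QuadraticMap.polar H (Pi.single 0 1) (Pi.single 1 1) * x 0 * x 1 +
      QuadraticMap.polar H (Pi.single 0 1) (Pi.single 2 1) * x 0 * x 2 +
      QuadraticMap.polar H (Pi.single 0 1) (Pi.single 3 1) * x 0 * x 3 +
      QuadraticMap.polar H (Pi.single 1 1) (Pi.single 2 1) * x 1 * x 2 +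
      QuadraticMap.polar H (Pi.single 1 1) (Pi.single 3 1) * x 1 * x 3 +
      QuadraticMap.polar H (Pi.single 2 1) (Pi.single 3 1) * x 2 * x 3 := by
  have hx : x = x 0 • Pi.single 0 1 + x 1 • Pi.single 1 1 + x 2 • Pi.single 2 1 +
      x 3 • Pi.single 3 1 := by
    ext i
    fin_cases i <;> simp
  conv_lhs => rw [hx]
  simp only [QuadraticMap.map_add H, QuadraticMap.map_smul, QuadraticMap.polar_add_left,
    QuadraticMap.polar_smul_left, QuadraticMap.polar_smul_right, smul_eq_mul]
  ring

/-- A vector orthogonal to a hyperbolic pair, which together with the pair and a given vector of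
the radical forms a basis of `k⁴`. -/
theorem QuadraticForm.exists_linearIndependent_orthogonal (F : QuadraticForm k (Fin 4 → k))
    {v x y : Fin 4 → k} (hv : v ≠ 0) (hvF : ∀ u, QuadraticMap.polar F v u = 0)
    (hx : QuadraticMap.polar F x x = 0) (hy : QuadraticMap.polar F y y = 0)
    (hxy : QuadraticMap.polar F x y ≠ 0) :
    ∃ w, w ∉ Submodule.span k {v} ∧ QuadraticMap.polar F x w = 0 ∧ QuadraticMap.polar F y w = 0 ∧
      LinearIndependent k ![x, w, v, y] := by
  let T := (F.polarBilin x).prod (F.polarBilin y)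
  have hnot : ¬ LinearMap.ker T ≤ Submodule.span k {v} := by
    intro hle
    have h1 := Submodule.finrank_mono hle
    have h2 := LinearMap.finrank_range_add_finrank_ker T
    have h3 := Submodule.finrank_le (LinearMap.range T)
    rw [finrank_span_singleton hv] at h1
    simp at h2 h3
    omega
  obtain ⟨w, hw, hwv⟩ := SetLike.not_le_iff_exists.1 hnot
  have hw' : QuadraticMap.polar F x w = 0 ∧ QuadraticMap.polar F y w = 0 := by
    simpa [T, LinearMap.mem_ker] using hw
  refine ⟨w, hwv, hw'.1, hw'.2, ?_⟩
  rw [Fintype.linearIndependent_iff]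
  intro c hc
  simp only [Fin.sum_univ_four, Matrix.cons_val] at hc
  have hx' := congrArg (F.polarBilin x) hc
  have hy' := congrArg (F.polarBilin y) hc
  simp only [map_add, map_smul, QuadraticMap.polarBilin_apply_apply, hx, hy, hw'.1, hw'.2,
    QuadraticMap.polar_comm F _ v, hvF, map_zero, smul_eq_mul, mul_zero, zero_add, add_zero]
    at hx' hy'
  have h3 : c 3 = 0 := (mul_eq_zero.1 hx').resolve_right hxy
  have h0 : c 0 = 0 := (mul_eq_zero.1 hy').resolve_right (by rwa [QuadraticMap.polar_comm])
  rw [h0, h3] at hc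
  simp only [zero_smul, zero_add, add_zero] at hc
  have h1 : c 1 = 0 := by
    by_contra h1
    refine hwv (Submodule.mem_span_singleton.2 ⟨-(c 1)⁻¹ * c 2, ?_⟩)
    have := congrArg (fun z => (c 1)⁻¹ • z) hc
    simp only [smul_add, smul_smul, inv_mul_cancel₀ h1, one_smul, smul_zero] at this
    rw [neg_mul, neg_smul, neg_eq_iff_add_eq_zero, add_comm, this]
  rw [h1, zero_smul, zero_add] at hc
  have h2 : c 2 = 0 := (smul_eq_zero.1 hc).resolve_right hv
  intro i
  fin_cases i <;> assumption

theorem linearMap_eq_zero_of_linearIndependent {x : Fin 4 → Fin 4 → k}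
    (hx : LinearIndependent k x) {l : (Fin 4 → k) →ₗ[k] k} (hl : ∀ i, l (x i) = 0) : l = 0 :=
  (basisOfLinearIndependentOfCardEqFinrank hx (by simp)).ext fun i => by simpa using hl i

theorem exists_smul_add_notMem_span {v : Fin 4 → k} (hv : v ≠ 0) :
    ∃ x y : Fin 4 → k, ∀ s t : k, (s ≠ 0 ∨ t ≠ 0) → s • x + t • y ∉ Submodule.span k {v} := by
  obtain ⟨i, hi⟩ := Function.ne_iff.1 hv
  refine ⟨Pi.single (i + 1) 1, Pi.single (i + 2) 1, fun s t hst h => ?_⟩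
  obtain ⟨c, hc⟩ := Submodule.mem_span_singleton.1 h
  have h0 := congrFun hc i
  have h1 := congrFun hc (i + 1)
  have h2 := congrFun hc (i + 2)
  have hc0 : c = 0 := by
    simpa [show v i ≠ 0 from hi] using h0
  simp [hc0] at h1 h2
  rcases hst with hs | ht
  · exact hs h1.symm
  · exact ht h2.symm

theorem smul_add_smul_ne_zero {v w : Fin 4 → k} (hv : v ≠ 0) (hwv : w ∉ Submodule.span k {v})
    {s t : k} (hst : s ≠ 0 ∨ t ≠ 0) : s • v + t • w ≠ 0 := by
  intro h1
  have ht : t = 0 := by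
    by_contra ht
    refine hwv (Submodule.mem_span_singleton.2 ⟨-t⁻¹ * s, ?_⟩)
    have := congrArg (fun z => t⁻¹ • z) h1
    simp only [smul_add, smul_smul, inv_mul_cancel₀ ht, one_smul, smul_zero] at this
    rw [neg_mul, neg_smul, neg_eq_iff_add_eq_zero, this]
  rw [ht, zero_smul, add_zero] at h1
  exact (smul_ne_zero (hst.resolve_right (not_not.2 ht)) hv) h1

variable [IsAlgClosed k]

/-- A quadratic cone over a smooth conic has the normal form `x₀x₃ - x₁²`, in which the vertex and
a given further point of the cone are coordinate points. -/
theorem QuadraticForm.exists_conicFun (F : QuadraticForm k (Fin 4 → k)) {v E : Fin 4 → k}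
    (hv : v ≠ 0) (hFv : F v = 0) (hvF : ∀ u, QuadraticMap.polar F v u = 0)
    (hrad : ∀ w, F w = 0 → (∀ u, QuadraticMap.polar F w u = 0) → w ∈ Submodule.span k {v})
    (hE : F E = 0) (hEv : E ∉ Submodule.span k {v}) :
    ∃ L : (Fin 4 → k) ≃ₗ[k] (Fin 4 → k), L (Pi.single 2 1) = v ∧ L (Pi.single 3 1) = E ∧
      ∀ x, F (L x) = conicFun x := by
  obtain ⟨u, hu⟩ : ∃ u, QuadraticMap.polar F E u = 1 := by
    by_contra! h
    refine hEv (hrad E hE fun u => ?_)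
    by_contra h0
    refine h ((QuadraticMap.polar F E u)⁻¹ • u) ?_
    rw [QuadraticMap.polar_smul_right, smul_eq_mul, inv_mul_cancel₀ h0]
  have hEE : QuadraticMap.polar F E E = 0 := by simp [hE]
  set e := u - F u • E with he
  have hEe : QuadraticMap.polar F E e = 1 := by
    simp [he, sub_eq_add_neg, QuadraticMap.polar_add_right,
      QuadraticMap.polar_smul_right, hEE, hu, -neg_smul]
  have hFe : F e = 0 := by
    rw [he, sub_eq_add_neg, ← neg_smul, QuadraticMap.map_add F, QuadraticMap.map_smul,
      QuadraticMap.polar_smul_right, QuadraticMap.polar_comm, hu, hE]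
    simp
  have hee : QuadraticMap.polar F e e = 0 := by simp [hFe]
  obtain ⟨w, hwv, hew, hEw, hli⟩ := F.exists_linearIndependent_orthogonal hv hvF hee hEE
    (by rw [QuadraticMap.polar_comm, hEe]; exact one_ne_zero)
  have hFw : F w ≠ 0 := by
    intro h0
    refine hwv (hrad w h0 fun u => ?_)
    have : F.polarBilin w = 0 := linearMap_eq_zero_of_linearIndependent hli fun i => by
      fin_cases i
      · simpa [QuadraticMap.polar_comm F w] using hew
      · simp [h0]
      · simpa [QuadraticMap.polar_comm F w] using hvF w
      · simpa [QuadraticMap.polar_comm F w] using hEw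
    simpa using congrArg (fun l => l u) this
  obtain ⟨d, hd⟩ := IsAlgClosed.exists_pow_nat_eq (-(F w)⁻¹) (show 0 < 2 by norm_num)
  have hd0 : d ≠ 0 := by
    rintro rfl
    simp [hFw] at hd
  have hli' : LinearIndependent k ![e, d • w, v, E] := by
    convert hli.units_smul ![1, Units.mk0 d hd0, 1, 1] using 1
    ext i
    fin_cases i <;> simp [Units.smul_def]
  have hFd : F (d • w) = -1 := by
    rw [QuadraticMap.map_smul, smul_eq_mul, ← sq, hd]
    field_simp
  let b := basisOfLinearIndependentOfCardEqFinrank hli' (by simp)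
  have hb : ⇑b = ![e, d • w, v, E] := coe_basisOfLinearIndependentOfCardEqFinrank _ _
  refine ⟨b.equivFun.symm, ?_, ?_, fun x => ?_⟩
  · simp [Module.Basis.equivFun_symm_apply, hb]
  · simp [Module.Basis.equivFun_symm_apply, hb]
  · rw [Module.Basis.equivFun_symm_apply, hb, Fin.sum_univ_four]
    simp only [Matrix.cons_val]
    simp only [QuadraticMap.map_add F, QuadraticMap.map_smul, QuadraticMap.polar_add_left,
      QuadraticMap.polar_smul_left, QuadraticMap.polar_smul_right, smul_eq_mul, hFe, hFd, hFv, hE,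
      QuadraticMap.polar_comm F _ v, hvF, QuadraticMap.polar_comm F e E, hEe,
      QuadraticMap.polar_comm F w E, hEw, hew, conicFun]
    ring

theorem exists_quartic_form_eq_zero (c₀ c₁ c₂ c₃ c₄ : k) : ∃ s t : k, (s ≠ 0 ∨ t ≠ 0) ∧
    c₀ * s ^ 4 + c₁ * s ^ 3 * t + c₂ * s ^ 2 * t ^ 2 + c₃ * s * t ^ 3 + c₄ * t ^ 4 = 0 := by
  by_cases h0 : c₀ = 0
  · exact ⟨1, 0, by simp, by simp [h0]⟩
  have hdeg : (Polynomial.C c₀ * .X ^ 4 + .C c₁ * .X ^ 3 + .C c₂ * .X ^ 2 + .C c₃ * .X +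
      .C c₄ : Polynomial k).degree = 4 := by
    compute_degree!
  obtain ⟨s, hs⟩ := IsAlgClosed.exists_root _ (by rw [hdeg]; decide)
  exact ⟨s, 1, by simp, by simpa using hs⟩

theorem QuadraticForm.exists_add_smul_eq_zero (F : QuadraticForm k (Fin 4 → k))
    (x y : Fin 4 → k) : ∃ s t : k, (s ≠ 0 ∨ t ≠ 0) ∧ F (s • x + t • y) = 0 := by
  by_cases h0 : F x = 0
  · exact ⟨1, 0, by simp, by simpa⟩
  obtain ⟨s, hs⟩ := exists_monic_quadratic_eq_zero (QuadraticMap.polar F x y / F x) (F y / F x)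
  refine ⟨s, 1, by simp, ?_⟩
  rw [QuadraticMap.map_add F, QuadraticMap.map_smul, QuadraticMap.polar_smul_left]
  simp only [one_smul, smul_eq_mul]
  field_simp at hs
  linear_combination hs

/-- A pencil of quadrics which contains a singular member with smooth base locus can be brought
into Weierstrass form. -/
theorem SmoothPencil.exists_weierstrassFun_of_singular {F G : QuadraticForm k (Fin 4 → k)}
    (h : SmoothPencil F G) {v : Fin 4 → k} (hv : v ≠ 0) (hFv : F v = 0)
    (hvF : ∀ u, QuadraticMap.polar F v u = 0) :
    ∃ a₁ a₂ a₃ a₄ a₆ : k, PencilEquiv F G conicFun (weierstrassFun a₁ a₂ a₃ a₄ a₆) := by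
  have hGv : G v ≠ 0 := fun h0 =>
    one_ne_zero (h v hv hFv h0 1 0 (by simp [hvF])).1
  wlog hGv1 : G v = 1 generalizing G
  · have hE : PencilEquiv F G F ((G v)⁻¹ • G : QuadraticForm k (Fin 4 → k)) :=
      .of_coeffs ![1, 0, 0, (G v)⁻¹] (by simp [hGv]) (by simp) (by simp)
    obtain ⟨a₁, a₂, a₃, a₄, a₆, hE'⟩ := this (h.of_pencilEquiv hE) (by simp [hGv]) (by simp [hGv])
    exact ⟨a₁, a₂, a₃, a₄, a₆, hE.trans hE'⟩
  have hrad : ∀ w, F w = 0 → (∀ u, QuadraticMap.polar F w u = 0) → w ∈ Submodule.span k {v} := by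
    intro w hFw hwF
    by_contra hwv
    obtain ⟨s, t, hst, h0⟩ := G.exists_add_smul_eq_zero v w
    refine one_ne_zero (h _ (smul_add_smul_ne_zero hv hwv hst) ?_ h0 1 0 fun u => ?_).1
    · simp [QuadraticMap.map_add F, QuadraticMap.map_smul, hFv, hFw, QuadraticMap.polar_smul_left,
        hvF]
    · simp [QuadraticMap.polar_add_left, QuadraticMap.polar_smul_left, hvF, hwF]
  obtain ⟨x, y, hxy⟩ := exists_smul_add_notMem_span hv
  obtain ⟨s₀, t₀, hst₀, h₀⟩ := F.exists_add_smul_eq_zero x y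
  obtain ⟨L, hLv, -, hL⟩ := F.exists_conicFun hv hFv hvF hrad h₀ (hxy _ _ hst₀)
  obtain ⟨E, hFE, hGE, hGEv, hEv⟩ : ∃ E, F E = 0 ∧ G E = 0 ∧ QuadraticMap.polar G v E = 0 ∧
      E ∉ Submodule.span k {v} := by
    let H : QuadraticForm k (Fin 4 → k) := G.comp L.toLinearMap
    have hH := H.apply_fin_four
    have hH2 : H (Pi.single 2 1) = 1 := by simp [H, hLv, hGv1]
    have hHv (z : Fin 4 → k) : QuadraticMap.polar G v (L z) =
        QuadraticMap.polar H (Pi.single 2 1) z := by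
      simp [QuadraticMap.polar, H, hLv]
    rw [hH2] at hH
    generalize H (Pi.single 0 1) = d₀ at hH
    generalize H (Pi.single 1 1) = d₁ at hH
    generalize H (Pi.single 3 1) = d₃ at hH
    generalize QuadraticMap.polar H (Pi.single 0 1) (Pi.single 1 1) = c₀₁ at hH
    generalize QuadraticMap.polar H (Pi.single 0 1) (Pi.single 2 1) = c₀₂ at hH
    generalize QuadraticMap.polar H (Pi.single 0 1) (Pi.single 3 1) = c₀₃ at hH
    generalize QuadraticMap.polar H (Pi.single 1 1) (Pi.single 2 1) = c₁₂ at hH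
    generalize QuadraticMap.polar H (Pi.single 1 1) (Pi.single 3 1) = c₁₃ at hH
    generalize QuadraticMap.polar H (Pi.single 2 1) (Pi.single 3 1) = c₂₃ at hH
    obtain ⟨s, t, hst, hD⟩ := exists_quartic_form_eq_zero (c₀₂ ^ 2 - 4 * d₀)
      (2 * c₀₂ * c₁₂ - 4 * c₀₁) (c₁₂ ^ 2 + 2 * c₀₂ * c₂₃ - 4 * (d₁ + c₀₃))
      (2 * c₁₂ * c₂₃ - 4 * c₁₃) (c₂₃ ^ 2 - 4 * d₃)
    obtain ⟨z, hz⟩ := exists_monic_quadratic_eq_zero (c₀₂ * s ^ 2 + c₁₂ * s * t + c₂₃ * t ^ 2)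
      (d₀ * s ^ 4 + c₀₁ * s ^ 3 * t + (d₁ + c₀₃) * s ^ 2 * t ^ 2 + c₁₃ * s * t ^ 3 + d₃ * t ^ 4)
    have hz' : 2 * z + (c₀₂ * s ^ 2 + c₁₂ * s * t + c₂₃ * t ^ 2) = 0 := by
      rw [← sq_eq_zero_iff]
      linear_combination hD + 4 * hz
    refine ⟨L ![s ^ 2, s * t, z, t ^ 2], ?_, ?_, ?_, ?_⟩
    · rw [hL]
      simp [conicFun]
      ring
    · change H _ = 0
      rw [hH]
      simp
      linear_combination hz
    · rw [hHv]
      simp only [QuadraticMap.polar, hH]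
      simp
      linear_combination hz'
    · intro h1
      obtain ⟨c, hc⟩ := Submodule.mem_span_singleton.1 h1
      rw [← hLv, ← map_smul] at hc
      have hc' := L.injective hc
      have h0 := congrFun hc' 0
      have h3 := congrFun hc' 3
      simp at h0 h3
      rcases hst with hs | ht
      · exact hs (by simpa using h0.symm)
      · exact ht (by simpa using h3.symm)
  obtain ⟨L, hLv, hLE, hL⟩ := F.exists_conicFun hv hFv hvF hrad hFE hEv
  let H : QuadraticForm k (Fin 4 → k) := G.comp L.toLinearMap
  have hE : PencilEquiv F G conicFun H := .of_linearEquiv L (fun x => (hL x).symm) fun x => rfl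
  have hH2 : H (Pi.single 2 1) = 1 := by simp [H, hLv, hGv1]
  have hH3 : H (Pi.single 3 1) = 0 := by simp [H, hLE, hGE]
  have hH23 : QuadraticMap.polar H (Pi.single 2 1) (Pi.single 3 1) = 0 := by
    rw [← hGEv]
    simp [QuadraticMap.polar, H, hLv, hLE]
  obtain ⟨a₁, a₂, a₃, a₄, a₆, hE'⟩ := SmoothPencil.exists_weierstrassFun (G := H)
    (c₁₂ := QuadraticMap.polar H (Pi.single 1 1) (Pi.single 2 1))
    (c₀₂ := QuadraticMap.polar H (Pi.single 0 1) (Pi.single 2 1))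
    (c₁₃ := QuadraticMap.polar H (Pi.single 1 1) (Pi.single 3 1))
    (c₀₃ := QuadraticMap.polar H (Pi.single 0 1) (Pi.single 3 1))
    (c₁₁ := H (Pi.single 1 1))
    (c₀₁ := QuadraticMap.polar H (Pi.single 0 1) (Pi.single 1 1))
    (c₀₀ := H (Pi.single 0 1))
    (fun x => by
      rw [H.apply_fin_four, hH2, hH3, hH23]
      ring) (h.of_pencilEquiv hE)
  exact ⟨a₁, a₂, a₃, a₄, a₆, hE.trans hE'⟩

end QuadraticForms

section SingularMember

variable {k : Type*} [Field k]

theorem MvPolynomial.IsHomogeneous.exists_quadraticForm {f : MvPolynomial (Fin 4) k}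
    (hf : f.IsHomogeneous 2) : ∃ Q : QuadraticForm k (Fin 4 → k), (∀ x, Q x = eval x f) ∧
      ∀ x v, QuadraticMap.polar Q x v = ∑ i, eval x (pderiv i f) * v i := by
  have hmem : f ∈ Submodule.span k
      (Set.range fun i : Fin 4 × Fin 4 => (X i.1 * X i.2 : MvPolynomial (Fin 4) k)) := by
    rw [f.as_sum]
    refine sum_mem fun m hm => ?_
    have hdeg : m.degree = 2 := by
      simpa [Finsupp.degree_eq_weight_one] using! hf (mem_support_iff.1 hm)
    rw [Finsupp.degree_eq_sum] at hdeg
    have hcard : Multiset.card (Finsupp.toMultiset m) = 2 := by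
      rw [Finsupp.card_toMultiset, Finsupp.sum_fintype _ _ (by simp)]
      exact hdeg
    obtain ⟨i, j, hij⟩ := Multiset.card_eq_two.1 hcard
    have hm' : m = Finsupp.single i 1 + Finsupp.single j 1 := by
      apply Multiset.toFinsupp.symm.injective
      simp [hij]
    rw [← mul_one (coeff m f), ← smul_eq_mul, ← smul_monomial]
    refine Submodule.smul_mem _ _ (Submodule.subset_span ⟨(i, j), ?_⟩)
    simp [hm', X, monomial_mul]
  clear hf
  induction hmem using Submodule.span_induction with
  | mem f hf =>
    obtain ⟨⟨i, j⟩, rfl⟩ := hf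
    refine ⟨QuadraticMap.linMulLin (LinearMap.proj i) (LinearMap.proj j), by simp, fun x v => ?_⟩
    simp [QuadraticMap.polar, Pi.single_apply, add_mul, Finset.sum_add_distrib, apply_ite (eval x)]
    ring
  | zero => exact ⟨0, by simp, by simp [QuadraticMap.polar]⟩
  | add f g _ _ hf hg =>
    obtain ⟨Q, hQ, hQ'⟩ := hf
    obtain ⟨Q', hQ₁, hQ₁'⟩ := hg
    refine ⟨Q + Q', by simp [hQ, hQ₁], fun x v => ?_⟩
    simp [QuadraticMap.polar_add, hQ', hQ₁', add_mul, Finset.sum_add_distrib]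
  | smul r f _ hf =>
    obtain ⟨Q, hQ, hQ'⟩ := hf
    refine ⟨r • Q, by simp [hQ, smul_eval], fun x v => ?_⟩
    simp [QuadraticMap.polar_smul, hQ', smul_eval, Finset.mul_sum, mul_assoc]

theorem exists_polar_zero_notMem_span [CharP k 2] (F : QuadraticForm k (Fin 4 → k))
    {v : Fin 4 → k} (hv : v ≠ 0) (hvF : ∀ u, QuadraticMap.polar F v u = 0) :
    ∃ w, w ∉ Submodule.span k {v} ∧ ∀ u, QuadraticMap.polar F w u = 0 := by
  have h2 : (2 : k) = 0 := CharTwo.two_eq_zero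
  have halt (x : Fin 4 → k) : QuadraticMap.polar F x x = 0 := by simp [h2]
  by_cases h : ∀ x y, QuadraticMap.polar F x y = 0
  · obtain ⟨x, y, hxy⟩ := exists_smul_add_notMem_span hv
    exact ⟨_, hxy 1 0 (by simp), fun u => h _ u⟩
  push Not at h
  obtain ⟨x, y, hxy⟩ := h
  obtain ⟨w, hwv, hxw, hyw, hli⟩ :=
    F.exists_linearIndependent_orthogonal hv hvF (halt x) (halt y) hxy
  refine ⟨w, hwv, fun u => ?_⟩
  have : F.polarBilin w = 0 := linearMap_eq_zero_of_linearIndependent hli fun i => by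
    fin_cases i
    · simpa [QuadraticMap.polar_comm F w] using hxw
    · exact halt w
    · simpa [QuadraticMap.polar_comm F w] using hvF w
    · simpa [QuadraticMap.polar_comm F w] using hyw
  simpa using congrArg (fun l => l u) this

variable [IsAlgClosed k]

theorem exists_singular_zero (F : QuadraticForm k (Fin 4 → k))
    {v : Fin 4 → k} (hv : v ≠ 0) (hvF : ∀ u, QuadraticMap.polar F v u = 0) :
    ∃ w, w ≠ 0 ∧ F w = 0 ∧ ∀ u, QuadraticMap.polar F w u = 0 := by
  by_cases h2 : (2 : k) = 0
  · have : CharP k 2 := CharTwo.of_one_ne_zero_of_two_eq_zero one_ne_zero h2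
    obtain ⟨w, hwv, hwF⟩ := exists_polar_zero_notMem_span F hv hvF
    obtain ⟨s, t, hst, h0⟩ := F.exists_add_smul_eq_zero v w
    refine ⟨_, smul_add_smul_ne_zero hv hwv hst, h0, fun u => ?_⟩
    simp [QuadraticMap.polar_add_left, QuadraticMap.polar_smul_left, hvF, hwF]
  · have := hvF v
    rw [QuadraticMap.polar_self, nsmul_eq_mul, Nat.cast_ofNat] at this
    exact ⟨v, hv, (mul_eq_zero.1 this).resolve_left h2, hvF⟩

theorem exists_radical_of_pencil (F G : QuadraticForm k (Fin 4 → k)) :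
    ∃ s t : k, (s ≠ 0 ∨ t ≠ 0) ∧ ∃ v, v ≠ 0 ∧
      ∀ u, QuadraticMap.polar (s • F + t • G) v u = 0 := by
  by_cases hG : Function.Injective G.polarBilin
  · let e := LinearMap.linearEquivOfInjective (V₂ := Module.Dual k (Fin 4 → k)) G.polarBilin hG
      (Subspace.dual_finrank_eq).symm
    obtain ⟨μ, hμ⟩ := Module.End.exists_eigenvalue (e.symm.toLinearMap ∘ₗ F.polarBilin)
    obtain ⟨v, hv⟩ := hμ.exists_hasEigenvector
    refine ⟨1, -μ, by simp, v, hv.2, fun u => ?_⟩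
    have h1 := congrArg e hv.apply_eq_smul
    rw [map_smul] at h1
    have h2 : F.polarBilin v = μ • G.polarBilin v := by
      simpa [e] using h1
    have h3 := congrArg (fun l => l u) h2
    simp only [QuadraticMap.polarBilin_apply_apply, LinearMap.smul_apply, smul_eq_mul] at h3
    rw [FunLike.coe_add, FunLike.coe_smul, FunLike.coe_smul,
      QuadraticMap.polar_add, QuadraticMap.polar_smul, QuadraticMap.polar_smul, h3]
    simp
  · rw [← LinearMap.ker_eq_bot, Submodule.eq_bot_iff] at hG
    push Not at hG
    obtain ⟨v, hv, hv0⟩ := hG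
    refine ⟨0, 1, by simp, v, hv0, fun u => ?_⟩
    simpa using congrArg (fun l => l u) hv

theorem SmoothPencil.exists_pencilEquiv_threeTorsion (h3 : (3 : k) ≠ 0)
    {F G : QuadraticForm k (Fin 4 → k)} (h : SmoothPencil F G) :
    ∃ a b : k, b ≠ 0 ∧ b - a ^ 3 ≠ 0 ∧
      PencilEquiv F G conicFun (weierstrassFun (3 * a) 0 b 0 0) := by
  obtain ⟨s, t, hst, v, hv, hvF⟩ := exists_radical_of_pencil F G
  obtain ⟨w, hw, hFw, hwF⟩ := exists_singular_zero _ hv hvF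
  obtain ⟨G', hE⟩ : ∃ G' : QuadraticForm k (Fin 4 → k),
      PencilEquiv F G (s • F + t • G : QuadraticForm k (Fin 4 → k)) G' := by
    by_cases hs : s = 0
    · exact ⟨F, .of_coeffs ![s, t, 1, 0] (by simpa [hs] using hst) (by simp) (by simp)⟩
    · exact ⟨G, .of_coeffs ![s, t, 0, 1] (by simpa using hs) (by simp) (by simp)⟩
  have h' := h.of_pencilEquiv hE
  obtain ⟨a₁, a₂, a₃, a₄, a₆, hE'⟩ := h'.exists_weierstrassFun_of_singular hw hFw hwF
  obtain ⟨a, b, hb, hab, hE''⟩ := (h'.of_pencilEquiv hE').exists_threeTorsion h3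
  exact ⟨a, b, hb, hab, hE.trans (hE'.trans hE'')⟩

end SingularMember

/-- The Hilbert–Kunz function of the maximal ideal of the homogeneous coordinate ring
`k[X₀,X₁,X₂,X₃]/(f,g)` of a smooth complete intersection of two quadrics in `ℙ³`
(an elliptic curve of degree 4) over an algebraically closed field of characteristic
`p > 0`, `p ≠ 3`, is `φ(q) = (8/3)q² − 5/3`, i.e. `3·φ(q) = 8q² − 5` for `q = p^e`. -/
theorem hilbert_kunz_function_complete_intersection_quadrics
    (k : Type*) [Field k] [IsAlgClosed k] (p : ℕ) (hp : 0 < p) (hp3 : p ≠ 3) [CharP k p]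
    (f g : MvPolynomial (Fin 4) k)
    (hf : f.IsHomogeneous 2) (hg : g.IsHomogeneous 2)
    (hnonempty : ∃ a : Fin 4 → k, a ≠ 0 ∧ eval a f = 0 ∧ eval a g = 0)
    (hsmooth : ∀ a : Fin 4 → k, a ≠ 0 → eval a f = 0 → eval a g = 0 →
      LinearIndependent k
        ![fun i : Fin 4 => eval a (pderiv i f), fun i : Fin 4 => eval a (pderiv i g)]) :
    ∀ e : ℕ,
      (3 * Module.finrank k
          (MvPolynomial (Fin 4) k ⧸
            Ideal.span {f, g, X 0 ^ p ^ e, X 1 ^ p ^ e, X 2 ^ p ^ e, X 3 ^ p ^ e}) : ℤ) =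
        8 * ((p : ℤ) ^ e) ^ 2 - 5 := by
  intro e
  have : Fact p.Prime := ⟨(CharP.char_is_prime_or_zero k p).resolve_right hp.ne'⟩
  have h3 : (3 : k) ≠ 0 := by
    intro h
    have : p ∣ 3 := (CharP.cast_eq_zero_iff k p 3).1 (by exact_mod_cast h)
    exact hp3 ((Nat.prime_dvd_prime_iff_eq Fact.out Nat.prime_three).1 this)
  obtain ⟨F, hF, hF'⟩ := hf.exists_quadraticForm
  obtain ⟨G, hG, hG'⟩ := hg.exists_quadraticForm
  have hFG : SmoothPencil F G := fun a ha hFa hGa s t hst => by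
    refine LinearIndependent.pair_iff.1 (hsmooth a ha (hF a ▸ hFa) (hG a ▸ hGa)) s t ?_
    ext i
    simpa [hF', hG', Pi.single_apply] using hst (Pi.single i 1)
  obtain ⟨a, b, hb, hab, hE⟩ := hFG.exists_pencilEquiv_threeTorsion h3
  rw [finrank_quotient_eq_of_pencilEquiv (a := a) (b := b) p e]
  · exact finrank_quotient_frobeniusIdeal p e hp3 hb hab
  · convert hE using 1
    · exact funext fun x => (hF x).symm
    · exact funext fun x => (hG x).symm
    · ext x
      simp [conicFun, conicForm]
    · ext x
      simp [weierstrassFun, weierstrassForm]
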